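/- There exists an absolute constant c > 0 with the following property. Let d ≥ 2, let K ⊆ ℝ^d be a convex body containing the origin in its interior, with smooth and strictly convex boundary (each boundary point has a unique outer unit normal, and ∂K contains no line segment), and suppose vol_d(K) · vol_d(K°) ≤ A · d^{-d} for some A ≥ 1. For a Borel set S ⊆ ∂K let S* = {x* : x ∈ S} ⊆ ∂K°, where x* = ν_x/⟨x, ν_x⟩ and ν_x is the outer unit normal to K at x; let C(S) = {rx : x ∈ S, 0 ≤ r ≤ 1} and C(S*) = {ry : y ∈ S*, 0 ≤ r ≤ 1}; and define μ(S) = (1/2)·(vol_d(C(S))/vol_d(K) + vol_d(C(S*))/vol_d(K°)). Then μ(∂K) = 1, and for every x ∈ ∂K and every ε ∈ (0, 1/2), the cap S(x, ε) = {y ∈ ∂K : ⟨y, ν_x⟩ ≥ (1−ε)⟨x, ν_x⟩} satisfies μ(S(x, ε)) ≥ c^d · A^{-1/2} · ε^{(d-1)/2}. -/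

import Mathlib

open scoped RealInnerProductSpace ENNReal
open MeasureTheory

/-- The (one-sided) polar body `K° = {y : ⟨x, y⟩ ≤ 1 for all x ∈ K}`. -/
def polarBody {d : ℕ} (K : Set (EuclideanSpace ℝ (Fin d))) :
    Set (EuclideanSpace ℝ (Fin d)) := {y | ∀ x ∈ K, ⟪x, y⟫ ≤ 1}

/-- The cone `C(S) = {r·x : x ∈ S, 0 ≤ r ≤ 1}` over a set `S`. -/
def coneSet {d : ℕ} (S : Set (EuclideanSpace ℝ (Fin d))) :
    Set (EuclideanSpace ℝ (Fin d)) :=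
  {y | ∃ x ∈ S, ∃ r : ℝ, 0 ≤ r ∧ r ≤ 1 ∧ y = r • x}

set_option linter.unusedSectionVars false

namespace BM

section Det
variable {E : Type*} [NormedAddCommGroup E] [InnerProductSpace ℝ E] [FiniteDimensional ℝ E]

/-- the map `(u, v) ↦ (u + s B v, v + t A u)` -/
noncomputable def blk (A B : E →L[ℝ] E) (s t : ℝ) : E × E →L[ℝ] E × E :=
  (ContinuousLinearMap.fst ℝ E E + s • B.comp (ContinuousLinearMap.snd ℝ E E)).prod
    (ContinuousLinearMap.snd ℝ E E + t • A.comp (ContinuousLinearMap.fst ℝ E E))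

noncomputable def mat (M : E →L[ℝ] E) : Matrix (Fin (Module.finrank ℝ E)) (Fin (Module.finrank ℝ E)) ℝ :=
  LinearMap.toMatrix (Module.finBasis ℝ E) (Module.finBasis ℝ E) (M : E →ₗ[ℝ] E)

theorem blk_det (A B : E →L[ℝ] E) (s t : ℝ) :
    (blk A B s t).det = (1 - (s * t) • mat (B.comp A)).det := by
  classical
  let b := Module.finBasis ℝ E
  have h1 : (blk A B s t).det = LinearMap.det ((blk A B s t : E × E →L[ℝ] E × E) : E × E →ₗ[ℝ] E × E) := rfl
  rw [h1, ← LinearMap.det_toMatrix (b.prod b)]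
  have h2 : LinearMap.toMatrix (b.prod b) (b.prod b) ((blk A B s t : E × E →L[ℝ] E × E) : E × E →ₗ[ℝ] E × E)
      = Matrix.fromBlocks 1 (s • mat B) (t • mat A) 1 := by
    ext i j
    rcases i with i | i <;> rcases j with j | j <;>
      simp [LinearMap.toMatrix_apply, blk, mat, b, Matrix.one_apply, Finsupp.single_apply, eq_comm]
  rw [h2, Matrix.det_fromBlocks_one₂₂]
  congr 2
  have : mat (B.comp A) = mat B * mat A := by
    unfold mat
    rw [← LinearMap.toMatrix_comp]
    rfl
  rw [this, Matrix.smul_mul, Matrix.mul_smul, smul_smul]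

noncomputable def cdet (M : E →L[ℝ] E) (z : ℂ) : ℂ :=
  (1 - z • (mat M).map (fun r : ℝ => (r : ℂ))).det

theorem cdet_ofReal (M : E →L[ℝ] E) (s : ℝ) :
    cdet M (s : ℂ) = (((1 - s • mat M).det : ℝ) : ℂ) := by
  unfold cdet
  have := RingHom.map_det (Complex.ofRealHom) (1 - s • mat M)
  simp only [Complex.ofRealHom_eq_coe] at this
  rw [this]
  congr 1
  ext i j
  simp [Matrix.one_apply]
  split_ifs <;> simp

theorem continuous_mat : Continuous (mat : (E →L[ℝ] E) → _) := by
  refine continuous_matrix fun i j => ?_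
  simp only [mat, LinearMap.toMatrix_apply]
  have h1 : Continuous fun M : E →L[ℝ] E => M (Module.finBasis ℝ E j) := by fun_prop
  have h2 : Continuous fun x : E => (Module.finBasis ℝ E).repr x i :=
    (LinearMap.continuous_of_finiteDimensional ((Module.finBasis ℝ E).coord i))
  exact h2.comp h1

theorem continuous_cdet : Continuous fun p : (E →L[ℝ] E) × ℂ => cdet p.1 p.2 := by
  unfold cdet
  refine Continuous.matrix_det ?_
  refine continuous_const.sub (continuous_snd.smul ?_)
  exact (continuous_mat.comp continuous_fst).matrix_map Complex.continuous_ofReal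

theorem differentiable_cdet (M : E →L[ℝ] E) : Differentiable ℂ (cdet M) := by
  unfold cdet
  simp only [Matrix.det_apply]
  simp only [Matrix.sub_apply, Matrix.smul_apply]
  fun_prop

theorem cdet_bound : ∃ C : ℝ, 0 ≤ C ∧ ∀ M : E →L[ℝ] E, ∀ z : ℂ, ‖M‖ ≤ 1 → ‖z‖ ≤ 4 → ‖cdet M z‖ ≤ C := by
  have : ProperSpace (E →L[ℝ] E) := FiniteDimensional.proper ℝ _
  have hc : IsCompact (Metric.closedBall (0 : E →L[ℝ] E) 1 ×ˢ Metric.closedBall (0 : ℂ) 4) :=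
    (isCompact_closedBall _ _).prod (isCompact_closedBall _ _)
  obtain ⟨C, hC⟩ := hc.exists_bound_of_continuousOn (continuous_cdet (E := E)).continuousOn
  refine ⟨max C 0, le_max_right _ _, fun M z hM hz => ?_⟩
  exact (hC (M, z) ⟨by simpa using hM, by simpa using hz⟩).trans (le_max_left _ _)

theorem det_pos_of_norm_lt (L : E →L[ℝ] E) (hL : ‖L‖ ≤ 1) (s : ℝ) (hs : |s| < 1) :
    0 < (1 - s • mat L).det := by
  classical
  let f : ℝ → ℝ := fun t => (1 - t • mat L).det
  have hf : Continuous f := by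
    refine Continuous.matrix_det ?_
    fun_prop
  have h0 : f 0 = 1 := by simp [f]
  have hne : ∀ t, |t| < 1 → f t ≠ 0 := by
    intro t ht h
    have he : (1 - t • mat L) = LinearMap.toMatrix (Module.finBasis ℝ E) (Module.finBasis ℝ E)
        ((1 - t • L : E →L[ℝ] E) : E →ₗ[ℝ] E) := by
      unfold mat
      rw [ContinuousLinearMap.toLinearMap_sub, map_sub, ContinuousLinearMap.toLinearMap_smul, map_smul]
      congr 1
      exact (LinearMap.toMatrix_one _).symm
    have h' : LinearMap.det ((1 - t • L : E →L[ℝ] E) : E →ₗ[ℝ] E) = 0 := by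
      rw [← LinearMap.det_toMatrix (Module.finBasis ℝ E), ← he]; exact h
    have hk := LinearMap.bot_lt_ker_of_det_eq_zero h'
    obtain ⟨x, hx, hx0⟩ := (Submodule.ne_bot_iff _).1 hk.ne'
    have hx' : x = t • L x := by
      have : x - t • L x = 0 := by simpa using hx
      exact sub_eq_zero.1 this
    have hn : ‖x‖ ≤ |t| * ‖x‖ := by
      calc ‖x‖ = ‖t • L x‖ := by rw [← hx']
        _ = |t| * ‖L x‖ := by rw [norm_smul, Real.norm_eq_abs]
        _ ≤ |t| * ‖x‖ := by
          gcongr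
          exact (L.le_opNorm x).trans (by nlinarith [norm_nonneg x])
    have : 0 < ‖x‖ := norm_pos_iff.2 hx0
    nlinarith
  by_contra hcon
  have hcon' : f s ≤ 0 := not_lt.1 hcon
  have : (0 : ℝ) ∈ f '' Set.uIcc 0 s := by
    apply intermediate_value_uIcc hf.continuousOn
    rw [h0]
    exact Set.mem_uIcc.2 (Or.inr ⟨hcon', by norm_num⟩)
  obtain ⟨t, ht, h⟩ := this
  refine hne t ?_ h
  have := Set.abs_sub_left_of_mem_uIcc ht
  simp at this
  linarith
end Det
end BM

namespace BM

section CoV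
variable {E : Type*} [NormedAddCommGroup E] [InnerProductSpace ℝ E] [FiniteDimensional ℝ E]
  [MeasurableSpace E] [BorelSpace E]

theorem haar_prod : (volume : Measure (E × E)).IsAddHaarMeasure := by
  rw [Measure.volume_eq_prod]; infer_instance

/-- the map `(u, v) ↦ (u + s g v, v + t g u)` -/
def GG (g : E → E) (s t : ℝ) (p : E × E) : E × E := (p.1 + s • g p.2, p.2 + t • g p.1)

theorem GG_hasFDerivAt {g : E → E} {p : E × E} (h1 : DifferentiableAt ℝ g p.1)
    (h2 : DifferentiableAt ℝ g p.2) (s t : ℝ) :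
    HasFDerivAt (GG g s t) (blk (fderiv ℝ g p.1) (fderiv ℝ g p.2) s t) p := by
  unfold GG blk
  refine HasFDerivAt.prodMk ?_ ?_
  · exact hasFDerivAt_fst.add ((h2.hasFDerivAt.comp p hasFDerivAt_snd).const_smul s)
  · exact hasFDerivAt_snd.add ((h1.hasFDerivAt.comp p hasFDerivAt_fst).const_smul t)

theorem GG_injective {g : E → E} (hg : LipschitzWith 1 g) {s t : ℝ} (hs : |s| < 1) (ht : |t| < 1) :
    Function.Injective (GG g s t) := by
  rintro ⟨u, v⟩ ⟨u', v'⟩ h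
  simp only [GG, Prod.mk.injEq] at h
  obtain ⟨h1, h2⟩ := h
  have e1 : u - u' = s • (g v' - g v) := by
    rw [smul_sub, sub_eq_sub_iff_add_eq_add]
    rw [h1, add_comm]
  have e2 : v - v' = t • (g u' - g u) := by
    rw [smul_sub, sub_eq_sub_iff_add_eq_add]
    rw [h2, add_comm]
  have l1 : ‖g v' - g v‖ ≤ ‖v - v'‖ := by
    have := hg.dist_le_mul v' v
    simpa [dist_eq_norm, norm_sub_rev] using this
  have l2 : ‖g u' - g u‖ ≤ ‖u - u'‖ := by
    have := hg.dist_le_mul u' u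
    simpa [dist_eq_norm, norm_sub_rev] using this
  have n1 : ‖u - u'‖ = |s| * ‖g v' - g v‖ := by rw [e1, norm_smul, Real.norm_eq_abs]
  have n2 : ‖v - v'‖ = |t| * ‖g u' - g u‖ := by rw [e2, norm_smul, Real.norm_eq_abs]
  have a1 : ‖u - u'‖ ≤ |s| * ‖v - v'‖ := by rw [n1]; gcongr
  have a2 : ‖v - v'‖ ≤ |t| * ‖u - u'‖ := by rw [n2]; gcongr
  have z1 : ‖u - u'‖ = 0 := by
    by_contra hne
    have : 0 < ‖u - u'‖ := lt_of_le_of_ne (norm_nonneg _) (Ne.symm hne)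
    have : |t| * ‖u - u'‖ < ‖u - u'‖ := by nlinarith
    nlinarith [abs_nonneg s, norm_nonneg (v - v')]
  have z2 : ‖v - v'‖ = 0 := by
    rw [z1] at a2
    simp at a2
    rw [a2, norm_zero]
  rw [norm_eq_zero, sub_eq_zero] at z1 z2
  rw [z1, z2]

theorem GG_surjective {g : E → E} (hg : LipschitzWith 1 g) {s t : ℝ} (hs : |s| < 1) (ht : |t| < 1) :
    Function.Surjective (GG g s t) := by
  rintro ⟨a, b⟩
  have : ProperSpace E := FiniteDimensional.proper ℝ _
  -- fixed point of u ↦ a - s g (b - t g u)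
  let f : E → E := fun u => a - s • g (b - t • g u)
  have hf : ContractingWith ⟨|s|, abs_nonneg s⟩ f := by
    refine ⟨by exact_mod_cast hs, LipschitzWith.of_dist_le_mul fun u u' => ?_⟩
    have l1 := hg.dist_le_mul (b - t • g u) (b - t • g u')
    have l2 := hg.dist_le_mul u u'
    simp only [dist_eq_norm, NNReal.coe_one, one_mul] at l1 l2 ⊢
    have e : f u - f u' = s • (g (b - t • g u') - g (b - t • g u)) := by
      simp only [f, smul_sub]; abel
    have e' : b - t • g u - (b - t • g u') = t • (g u' - g u) := by
      rw [smul_sub]; abel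
    rw [e', norm_smul, Real.norm_eq_abs, norm_sub_rev (g u')] at l1
    rw [e, norm_smul, Real.norm_eq_abs, norm_sub_rev]
    change _ ≤ |s| * ‖u - u'‖
    gcongr
    nlinarith [norm_nonneg (g u - g u')]
  refine ⟨(hf.fixedPoint f, b - t • g (hf.fixedPoint f)), ?_⟩
  have hfix := hf.fixedPoint_isFixedPt
  simp only [GG, Prod.mk.injEq]
  refine ⟨?_, by abel⟩
  have : a - s • g (b - t • g (hf.fixedPoint f)) = hf.fixedPoint f := hfix
  nth_rewrite 1 [← this]
  abel

theorem GG_lipschitz {g : E → E} (hg : LipschitzWith 1 g) {s t : ℝ} (hs : |s| < 1) (ht : |t| < 1) :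
    LipschitzWith 2 (GG g s t) := by
  refine LipschitzWith.of_dist_le_mul fun p q => ?_
  have l1 := hg.dist_le_mul p.1 q.1
  have l2 := hg.dist_le_mul p.2 q.2
  have m1 : dist p.1 q.1 ≤ dist p q := le_max_left _ _
  have m2 : dist p.2 q.2 ≤ dist p q := le_max_right _ _
  simp only [NNReal.coe_one, one_mul, NNReal.coe_ofNat] at l1 l2 ⊢
  have key : ∀ (r : ℝ) (x x' y y' : E), |r| < 1 → dist x x' ≤ dist p q → dist y y' ≤ dist p q →
      dist (x + r • y) (x' + r • y') ≤ 2 * dist p q := by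
    intro r x x' y y' hr h1 h2
    refine (dist_add_add_le _ _ _ _).trans ?_
    rw [dist_smul₀, Real.norm_eq_abs]
    nlinarith [dist_nonneg (x := y) (y := y'), abs_nonneg r]
  exact max_le (key s _ _ _ _ hs m1 (l2.trans m2)) (key t _ _ _ _ ht m2 (l1.trans m1))

/-- good set -/
def gset (g : E → E) : Set (E × E) := {u | DifferentiableAt ℝ g u} ×ˢ {u | DifferentiableAt ℝ g u}

theorem gset_meas (g : E → E) : MeasurableSet (gset g) :=
  (measurableSet_of_differentiableAt ℝ g).prod (measurableSet_of_differentiableAt ℝ g)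

theorem gset_ae {g : E → E} (hg : LipschitzWith 1 g) : ∀ᵐ p : E × E, p ∈ gset g := by
  have h := hg.ae_differentiableAt (μ := (volume : Measure E))
  have h1 : ∀ᵐ p : E × E, DifferentiableAt ℝ g p.1 :=
    (Measure.quasiMeasurePreserving_fst (μ := (volume : Measure E)) (ν := (volume : Measure E))).ae h
  have h2 : ∀ᵐ p : E × E, DifferentiableAt ℝ g p.2 :=
    (Measure.quasiMeasurePreserving_snd (μ := (volume : Measure E)) (ν := (volume : Measure E))).ae h
  filter_upwards [h1, h2] with p a b using ⟨a, b⟩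

theorem null_image {F : Type*} [NormedAddCommGroup F] [NormedSpace ℝ F] [FiniteDimensional ℝ F]
    [MeasurableSpace F] [BorelSpace F] (μ : Measure F) [μ.IsAddHaarMeasure] {f : F → F} {K : NNReal}
    (hf : LipschitzWith K f) {s : Set F} (hs : μ s = 0) : μ (f '' s) = 0 := by
  let H : Measure F := μH[Module.finrank ℝ F]
  have h1 : μ ≪ H := Measure.absolutelyContinuous_isAddHaarMeasure _ _
  have h2 : H ≪ μ := Measure.absolutelyContinuous_isAddHaarMeasure _ _
  apply h1
  have := hf.hausdorffMeasure_image_le (d := Module.finrank ℝ F) (by positivity) s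
  have h3 : H s = 0 := h2 hs
  change _ ≤ _ * H s at this
  rw [h3, mul_zero] at this
  exact le_antisymm this (zero_le)

theorem GG_image_ae {g : E → E} (hg : LipschitzWith 1 g) {s t : ℝ} (hs : |s| < 1) (ht : |t| < 1) :
    (GG g s t '' gset g : Set (E × E)) =ᵐ[volume] Set.univ := by
  have := haar_prod (E := E)
  rw [ae_eq_univ]
  have h : (GG g s t '' gset g)ᶜ ⊆ GG g s t '' (gset g)ᶜ := by
    intro q hq
    obtain ⟨p, rfl⟩ := GG_surjective hg hs ht q
    exact ⟨p, fun hp => hq ⟨p, hp, rfl⟩, rfl⟩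
  refine measure_mono_null h (null_image volume (GG_lipschitz hg hs ht) ?_)
  exact gset_ae hg

theorem real_cov {g : E → E} (hg : LipschitzWith 1 g) {s t : ℝ} (hs : |s| < 1) (ht : |t| < 1) :
    ∫ p : E × E, (1 - (s * t) • mat ((fderiv ℝ g p.2).comp (fderiv ℝ g p.1))).det *
      Real.exp (-(‖p.1 + s • g p.2‖ ^ 2 + ‖p.2 + t • g p.1‖ ^ 2)) =
    Real.pi ^ (Module.finrank ℝ E) := by
  have := haar_prod (E := E)
  have h := integral_image_eq_integral_abs_det_fderiv_smul (volume : Measure (E × E)) (gset_meas g)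
    (fun p hp => (GG_hasFDerivAt hp.1 hp.2 s t).hasFDerivWithinAt)
    ((GG_injective hg hs ht).injOn) (fun q => Real.exp (-(‖q.1‖ ^ 2 + ‖q.2‖ ^ 2)))
  have hu : gset g =ᵐ[volume] Set.univ := ae_eq_univ.2 (gset_ae hg)
  rw [setIntegral_congr_set (GG_image_ae hg hs ht), setIntegral_congr_set hu,
    setIntegral_univ, setIntegral_univ] at h
  have hnorm : ∀ x, ‖fderiv ℝ g x‖ ≤ 1 := fun x => by
    simpa using norm_fderiv_le_of_lipschitz ℝ hg (x₀ := x)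
  have hst : |s * t| < 1 := by
    rw [abs_mul]; nlinarith [abs_nonneg s, abs_nonneg t]
  have e : ∀ p : E × E, |(blk (fderiv ℝ g p.1) (fderiv ℝ g p.2) s t).det| •
        Real.exp (-(‖(GG g s t p).1‖ ^ 2 + ‖(GG g s t p).2‖ ^ 2)) =
      (1 - (s * t) • mat ((fderiv ℝ g p.2).comp (fderiv ℝ g p.1))).det *
      Real.exp (-(‖p.1 + s • g p.2‖ ^ 2 + ‖p.2 + t • g p.1‖ ^ 2)) := by
    intro p
    rw [blk_det, abs_of_pos, smul_eq_mul]
    · rfl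
    · refine det_pos_of_norm_lt _ ?_ _ hst
      refine (ContinuousLinearMap.opNorm_comp_le _ _).trans ?_
      have := hnorm p.1; have := hnorm p.2
      nlinarith [norm_nonneg (fderiv ℝ g p.1), norm_nonneg (fderiv ℝ g p.2)]
  simp only [e] at h
  rw [← h]
  have e2 : ∀ q : E × E, Real.exp (-(‖q.1‖ ^ 2 + ‖q.2‖ ^ 2)) =
      Real.exp (-1 * ‖q.1‖ ^ 2) * Real.exp (-1 * ‖q.2‖ ^ 2) := by
    intro q; rw [← Real.exp_add]; congr 1; ring
  simp only [e2]
  rw [Measure.volume_eq_prod, integral_prod_mul (fun x : E => Real.exp (-1 * ‖x‖ ^ 2))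
    (fun x : E => Real.exp (-1 * ‖x‖ ^ 2)),
    GaussianFourier.integral_rexp_neg_mul_sq_norm one_pos, ← Real.rpow_add (by positivity), div_one,
    add_halves, Real.rpow_natCast]
end CoV
end BM

namespace BM

theorem holo_integral {X : Type*} [MeasurableSpace X] {μ : Measure X} {f : ℂ → X → ℂ} {τ₀ : ℂ} {R : ℝ}
    (hR : 0 < R) (hmeas : ∀ τ, AEStronglyMeasurable (f τ) μ)
    (hdiff : ∀ x, Differentiable ℂ (fun τ => f τ x)) {bd : X → ℝ} (hbd : Integrable bd μ)
    (hb : ∀ τ ∈ Metric.ball τ₀ R, ∀ x, ‖f τ x‖ ≤ bd x) :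
    DifferentiableAt ℂ (fun τ => ∫ x, f τ x ∂μ) τ₀ := by
  have hd : ∀ x τ, HasDerivAt (fun τ => f τ x) (deriv (fun τ => f τ x) τ) τ :=
    fun x τ => (hdiff x τ).hasDerivAt
  have key := hasDerivAt_integral_of_dominated_loc_of_deriv_le (𝕜 := ℂ) (μ := μ) (F := f) (x₀ := τ₀)
    (F' := fun τ x => deriv (fun τ => f τ x) τ) (bound := fun x => bd x / (R / 3))
    (Metric.ball_mem_nhds τ₀ (by positivity : 0 < R / 3)) (Filter.Eventually.of_forall hmeas)
    (hbd.mono' (hmeas τ₀) (Filter.Eventually.of_forall (hb τ₀ (Metric.mem_ball_self hR)))) ?_ ?_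
    (hbd.div_const _) ?_
  · exact key.2.differentiableAt
  · have hlim : ∀ x, Filter.Tendsto (fun n : ℕ => ((n : ℂ) + 1) * (f (τ₀ + 1 / ((n : ℂ) + 1)) x - f τ₀ x))
        Filter.atTop (nhds (deriv (fun τ => f τ x) τ₀)) := by
      intro x
      have h1 := (hasDerivAt_iff_tendsto_slope_zero.1 (hd x τ₀))
      have h2 : Filter.Tendsto (fun n : ℕ => 1 / ((n : ℂ) + 1)) Filter.atTop (nhdsWithin 0 {0}ᶜ) := by
        refine tendsto_nhdsWithin_iff.2 ⟨tendsto_one_div_add_atTop_nhds_zero_nat, ?_⟩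
        refine Filter.Eventually.of_forall fun n => ?_
        have : ((n : ℂ) + 1) ≠ 0 := by exact_mod_cast Nat.succ_ne_zero n
        simpa using this
      have h3 := h1.comp h2
      refine h3.congr fun n => ?_
      simp
    refine aestronglyMeasurable_of_tendsto_ae Filter.atTop (fun n => ?_) (Filter.Eventually.of_forall hlim)
    exact ((hmeas _).sub (hmeas _)).const_mul _
  · refine Filter.Eventually.of_forall fun x τ hτ => ?_
    refine Complex.norm_deriv_le_of_forall_mem_sphere_norm_le (by positivity) (hdiff x).diffContOnCl ?_
    intro z hz
    apply hb
    rw [Metric.mem_ball] at hτ ⊢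
    rw [mem_sphere_iff_norm] at hz
    have := dist_triangle z τ τ₀
    rw [dist_eq_norm, dist_eq_norm z τ] at this
    rw [dist_eq_norm]
    linarith
  · exact Filter.Eventually.of_forall fun x τ _ => hd x τ

section An
variable {E : Type*} [NormedAddCommGroup E] [InnerProductSpace ℝ E] [FiniteDimensional ℝ E]
  [MeasurableSpace E] [BorelSpace E]

/-- `‖g u‖² + ‖g v‖²` -/
noncomputable def TT (g : E → E) (p : E × E) : ℝ := ‖g p.2‖ ^ 2 + ‖g p.1‖ ^ 2
noncomputable def II (g : E → E) (p : E × E) : ℝ := ⟪p.1, g p.2⟫ - ⟪p.2, g p.1⟫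
noncomputable def SS (p : E × E) : ℝ := ‖p.1‖ ^ 2 + ‖p.2‖ ^ 2

noncomputable def ff (g : E → E) (τ : ℂ) (p : E × E) : ℂ :=
  Complex.exp (-((SS p : ℂ) - τ ^ 2 * (TT g p : ℂ) + 2 * Complex.I * τ * (II g p : ℂ))) *
    cdet ((fderiv ℝ g p.2).comp (fderiv ℝ g p.1)) (τ ^ 2)

theorem ff_diff (g : E → E) (p : E × E) : Differentiable ℂ (fun τ => ff g τ p) := by
  unfold ff
  have := differentiable_cdet ((fderiv ℝ g p.2).comp (fderiv ℝ g p.1))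
  refine Differentiable.mul (by fun_prop) ?_
  exact this.comp (by fun_prop)

theorem ff_meas {g : E → E} (hg : LipschitzWith 1 g) (τ : ℂ) :
    AEStronglyMeasurable (ff g τ) (volume : Measure (E × E)) := by
  have hc := hg.continuous
  refine AEStronglyMeasurable.mul ?_ ?_
  · refine Continuous.aestronglyMeasurable ?_
    unfold SS TT II
    fun_prop
  · have hm : Measurable (fderiv ℝ g) := measurable_fderiv ℝ g
    have h1 : Measurable fun p : E × E => fderiv ℝ g p.1 := hm.comp measurable_fst
    have h2 : Measurable fun p : E × E => fderiv ℝ g p.2 := hm.comp measurable_snd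
    have hcomp : Continuous fun q : (E →L[ℝ] E) × (E →L[ℝ] E) => q.1.comp q.2 :=
      continuous_fst.clm_comp continuous_snd
    have h3 : Measurable fun p : E × E => (fderiv ℝ g p.2, fderiv ℝ g p.1) := h2.prodMk h1
    have hcd : Continuous fun q : (E →L[ℝ] E) × (E →L[ℝ] E) => cdet (q.1.comp q.2) (τ ^ 2) :=
      continuous_cdet.comp (hcomp.prodMk continuous_const)
    exact (hcd.measurable.comp h3).aestronglyMeasurable

theorem norm_fderiv_comp_le {g : E → E} (hg : LipschitzWith 1 g) (p : E × E) :
    ‖(fderiv ℝ g p.2).comp (fderiv ℝ g p.1)‖ ≤ 1 := by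
  have hnorm : ∀ x, ‖fderiv ℝ g x‖ ≤ 1 := fun x => by
    simpa using norm_fderiv_le_of_lipschitz ℝ hg (x₀ := x)
  refine (ContinuousLinearMap.opNorm_comp_le _ _).trans ?_
  have := hnorm p.1; have := hnorm p.2
  nlinarith [norm_nonneg (fderiv ℝ g p.1), norm_nonneg (fderiv ℝ g p.2)]

theorem lip_norm {g : E → E} (hg : LipschitzWith 1 g) (h0 : g 0 = 0) (x : E) : ‖g x‖ ≤ ‖x‖ := by
  have := hg.dist_le_mul x 0
  simpa [h0] using this

theorem TT_le {g : E → E} (hg : LipschitzWith 1 g) (h0 : g 0 = 0) (p : E × E) : TT g p ≤ SS p := by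
  have h1 := lip_norm hg h0 p.1
  have h2 := lip_norm hg h0 p.2
  unfold TT SS
  nlinarith [norm_nonneg (g p.1), norm_nonneg (g p.2)]

theorem II_le {g : E → E} (hg : LipschitzWith 1 g) (h0 : g 0 = 0) (p : E × E) : |II g p| ≤ SS p := by
  have h1 := lip_norm hg h0 p.1
  have h2 := lip_norm hg h0 p.2
  unfold II SS
  have a1 := abs_real_inner_le_norm p.1 (g p.2)
  have a2 := abs_real_inner_le_norm p.2 (g p.1)
  have := abs_sub (⟪p.1, g p.2⟫) (⟪p.2, g p.1⟫)
  nlinarith [norm_nonneg p.1, norm_nonneg p.2, sq_nonneg (‖p.1‖ - ‖p.2‖)]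

theorem SS_nonneg (p : E × E) : 0 ≤ SS p := by unfold SS; positivity

theorem ff_bound {g : E → E} (hg : LipschitzWith 1 g) (h0 : g 0 = 0) :
    ∃ C : ℝ, 0 ≤ C ∧ ∀ (δ : ℝ) (τ : ℂ), 0 < δ → δ ≤ 1 - τ.re ^ 2 - 2 * |τ.im| → ∀ p : E × E,
      ‖ff g τ p‖ ≤ C * Real.exp (-δ * SS p) := by
  obtain ⟨C, hC0, hC⟩ := cdet_bound (E := E)
  refine ⟨C, hC0, fun δ τ hδ hτ p => ?_⟩
  unfold ff
  rw [norm_mul, mul_comm, Complex.norm_exp]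
  have hre : (-((SS p : ℂ) - τ ^ 2 * (TT g p : ℂ) + 2 * Complex.I * τ * (II g p : ℂ))).re =
      -(SS p - (τ.re ^ 2 - τ.im ^ 2) * TT g p - 2 * τ.im * II g p) := by
    simp [pow_two]
    ring
  rw [hre]
  have hT := TT_le hg h0 p
  have hI := II_le hg h0 p
  have hS := SS_nonneg p
  have hT0 : 0 ≤ TT g p := by unfold TT; positivity
  have e1 : τ.im * II g p ≤ |τ.im| * SS p := by
    calc τ.im * II g p ≤ |τ.im * II g p| := le_abs_self _
      _ = |τ.im| * |II g p| := abs_mul _ _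
      _ ≤ _ := by gcongr
  have hab : |τ.im| ≤ 1 := by nlinarith [sq_nonneg τ.re, abs_nonneg τ.im]
  have him : τ.im ^ 2 ≤ 1 := by
    rw [← sq_abs]; nlinarith [abs_nonneg τ.im]
  gcongr
  · refine hC _ _ (norm_fderiv_comp_le hg p) ?_
    rw [norm_pow, Complex.sq_norm, Complex.normSq_apply]
    nlinarith [sq_nonneg τ.re, abs_nonneg τ.im]
  · nlinarith [sq_nonneg τ.re, sq_nonneg τ.im, mul_nonneg (sq_nonneg τ.im) hT0,
      mul_nonneg (sq_nonneg τ.re) (sub_nonneg.2 hT), mul_le_mul_of_nonneg_right hτ hS]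

theorem SS_integrable {δ : ℝ} (hδ : 0 < δ) :
    Integrable (fun p : E × E => Real.exp (-δ * SS p)) := by
  have h1 : Integrable fun x : E => Real.exp (-δ * ‖x‖ ^ 2) := by
    have hc := GaussianFourier.integrable_cexp_neg_mul_sq_norm_add (V := E) (b := (δ : ℂ)) (by simpa using hδ) 0 0
    have := hc.norm
    refine this.congr (Filter.Eventually.of_forall fun x => ?_)
    simp only [Complex.norm_exp]
    congr 1
    have : (-(δ : ℂ) * (‖x‖ : ℂ) ^ 2 + 0 * ((⟪(0:E), x⟫ : ℝ) : ℂ)) = ((-δ * ‖x‖ ^ 2 : ℝ) : ℂ) := by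
      push_cast; ring
    rw [this, Complex.ofReal_re]
  have h2 := h1.mul_prod h1
  rw [← Measure.volume_eq_prod] at h2
  refine h2.congr (Filter.Eventually.of_forall fun p => ?_)
  simp only [SS]
  rw [← Real.exp_add]; congr 1; ring

theorem ff_imag {g : E → E} (hg : LipschitzWith 1 g) (σ : ℝ) (hσ : |σ| < 1) :
    ∫ p : E × E, ff g (-(Complex.I * σ)) p = ((Real.pi ^ (Module.finrank ℝ E) : ℝ) : ℂ) := by
  rw [← real_cov hg hσ (t := -σ) (by simpa using hσ), ← integral_complex_ofReal]
  congr 1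
  ext p
  have e : (-(Complex.I * (σ : ℂ))) ^ 2 = ((-σ ^ 2 : ℝ) : ℂ) := by
    push_cast; rw [neg_sq, mul_pow, Complex.I_sq]; ring
  unfold ff
  rw [e, cdet_ofReal, mul_comm]
  push_cast
  congr 1
  · congr 3
    congr 1
    rw [show (σ * -σ) = -σ ^ 2 by ring]
  · congr 1
    have h1 : ‖p.1 + σ • g p.2‖ ^ 2 = ‖p.1‖ ^ 2 + 2 * σ * ⟪p.1, g p.2⟫ + σ ^ 2 * ‖g p.2‖ ^ 2 := by
      rw [norm_add_sq_real, inner_smul_right, norm_smul, mul_pow, Real.norm_eq_abs, sq_abs]; ring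
    have h2 : ‖p.2 + (-σ) • g p.1‖ ^ 2 = ‖p.2‖ ^ 2 - 2 * σ * ⟪p.2, g p.1⟫ + σ ^ 2 * ‖g p.1‖ ^ 2 := by
      rw [norm_add_sq_real, inner_smul_right, norm_smul, mul_pow, Real.norm_eq_abs, sq_abs]; ring
    have h3 : (2 : ℂ) * Complex.I * -(Complex.I * σ) = 2 * σ := by
      rw [show (2 : ℂ) * Complex.I * -(Complex.I * σ) = -(2 * σ) * (Complex.I ^ 2) by ring, Complex.I_sq]; ring
    rw [h3]
    have h4 := congrArg (fun r : ℝ => (r : ℂ)) h1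
    have h5 := congrArg (fun r : ℝ => (r : ℂ)) h2
    push_cast at h4 h5
    rw [h4, h5]
    unfold SS TT II
    push_cast
    ring

/-- Deformation invariance. -/
theorem ff_const {g : E → E} (hg : LipschitzWith 1 g) (h0 : g 0 = 0) {κ : ℝ} (hκ0 : 0 ≤ κ) (hκ : κ < 1) :
    ∫ p : E × E, ff g (κ : ℂ) p = ((Real.pi ^ (Module.finrank ℝ E) : ℝ) : ℂ) := by
  let Ω : Set ℂ := {τ | 0 < 1 - τ.re ^ 2 - 2 * |τ.im|}
  have hcont : Continuous fun τ : ℂ => 1 - τ.re ^ 2 - 2 * |τ.im| := by fun_prop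
  have hΩ : IsOpen Ω := isOpen_lt continuous_const hcont
  obtain ⟨C, hC0, hC⟩ := ff_bound hg h0
  have hdiff : DifferentiableOn ℂ (fun τ => ∫ p : E × E, ff g τ p) Ω := by
    intro τ₀ hτ₀
    refine DifferentiableAt.differentiableWithinAt ?_
    let δ := (1 - τ₀.re ^ 2 - 2 * |τ₀.im|) / 2
    have hδ : 0 < δ := half_pos hτ₀
    have hopen : IsOpen {τ : ℂ | δ < 1 - τ.re ^ 2 - 2 * |τ.im|} := isOpen_lt continuous_const hcont
    obtain ⟨R, hR, hsub⟩ := Metric.isOpen_iff.1 hopen τ₀ (show δ < _ from half_lt_self hτ₀)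
    exact holo_integral hR (ff_meas hg) (ff_diff g) ((SS_integrable hδ).const_mul C)
      (fun τ hτ p => hC δ τ hδ (hsub hτ).le p)
  have hconn : IsPreconnected Ω := by
    have : StarConvex ℝ (0 : ℂ) Ω := by
      rw [starConvex_zero_iff]
      intro τ hτ a ha0 ha1
      simp only [Ω, Set.mem_ofPred_eq] at hτ ⊢
      simp only [Complex.real_smul, Complex.mul_re, Complex.ofReal_re, Complex.ofReal_im, zero_mul, sub_zero,
        Complex.mul_im, add_zero, abs_mul, abs_of_nonneg ha0]
      have h1 : a * |τ.im| ≤ |τ.im| := mul_le_of_le_one_left (abs_nonneg _) ha1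
      have h2 : (a * τ.re) ^ 2 ≤ τ.re ^ 2 := by
        rw [mul_pow]
        exact mul_le_of_le_one_left (sq_nonneg _) (by nlinarith)
      linarith
    exact (this.isPathConnected (by simp [Ω])).isConnected.isPreconnected
  have h0Ω : (0 : ℂ) ∈ Ω := by simp [Ω]
  have hκΩ : (κ : ℂ) ∈ Ω := by
    simp only [Ω, Set.mem_ofPred_eq, Complex.ofReal_re, Complex.ofReal_im, abs_zero]; nlinarith
  have hfreq : ∃ᶠ τ in nhdsWithin (0 : ℂ) {0}ᶜ, (∫ p : E × E, ff g τ p) =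
      ((Real.pi ^ (Module.finrank ℝ E) : ℝ) : ℂ) := by
    have hlim : Filter.Tendsto (fun n : ℕ => -(Complex.I * ((1 / ((n : ℝ) + 2) : ℝ) : ℂ))) Filter.atTop
        (nhdsWithin 0 {0}ᶜ) := by
      refine tendsto_nhdsWithin_iff.2 ⟨?_, ?_⟩
      · have : Filter.Tendsto (fun n : ℕ => (1 / ((n : ℝ) + 2) : ℝ)) Filter.atTop (nhds 0) := by
          have h := (tendsto_one_div_add_atTop_nhds_zero_nat (𝕜 := ℝ)).comp (Filter.tendsto_add_atTop_nat 1)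
          refine h.congr fun n => ?_
          simp only [Function.comp]; push_cast; ring_nf
        have h2 := (Complex.continuous_ofReal.tendsto 0).comp this
        have h3 := (h2.const_mul Complex.I).neg
        simpa using h3
      · refine Filter.Eventually.of_forall fun n => ?_
        have : ((n : ℂ) + 2) ≠ 0 := by exact_mod_cast Nat.succ_ne_zero (n + 1)
        simpa using this
    refine hlim.frequently (Filter.Eventually.frequently (Filter.Eventually.of_forall fun n => ?_))
    refine ff_imag hg _ ?_
    rw [abs_of_pos (by positivity), div_lt_one (by positivity)]
    have : (0 : ℝ) ≤ n := Nat.cast_nonneg n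
    linarith
  exact (hdiff.analyticOnNhd hΩ).eqOn_of_preconnected_of_frequently_eq analyticOnNhd_const hconn h0Ω hfreq hκΩ
end An
end BM

namespace BM

section Up
variable {E : Type*} [NormedAddCommGroup E] [InnerProductSpace ℝ E] [FiniteDimensional ℝ E]
  [MeasurableSpace E] [BorelSpace E]

theorem cov_bound {g : E → E} (hg : LipschitzWith 1 g) (h0 : g 0 = 0) {κ : ℝ} (hκ0 : 0 ≤ κ) (hκ : κ < 1)
    (W : E × E → ℝ≥0∞)
    (hW : ∀ p : E × E, ENNReal.ofReal (Real.exp (-(SS p - κ ^ 2 * TT g p))) ≤ W (GG g κ κ p)) :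
    ENNReal.ofReal (Real.pi ^ (Module.finrank ℝ E)) ≤ ∫⁻ q : E × E, W q := by
  have := haar_prod (E := E)
  have hκ' : |κ| < 1 := by rwa [abs_of_nonneg hκ0]
  have h1 : ENNReal.ofReal (Real.pi ^ (Module.finrank ℝ E)) ≤ ∫⁻ p : E × E, ‖ff g (κ : ℂ) p‖ₑ := by
    have h := enorm_integral_le_lintegral_enorm (μ := (volume : Measure (E × E))) (ff g (κ : ℂ))
    rw [ff_const hg h0 hκ0 hκ] at h
    refine le_trans (le_of_eq ?_) h
    rw [← ofReal_norm, Complex.norm_real, Real.norm_eq_abs, abs_of_nonneg (by positivity)]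
  refine h1.trans ?_
  have hu : gset g =ᵐ[volume] Set.univ := ae_eq_univ.2 (gset_ae hg)
  rw [← setLIntegral_univ, ← setLIntegral_congr hu]
  have h2 := lintegral_image_eq_lintegral_abs_det_fderiv_mul (volume : Measure (E × E)) (gset_meas g)
    (fun p hp => (GG_hasFDerivAt hp.1 hp.2 κ κ).hasFDerivWithinAt)
    ((GG_injective hg hκ' hκ').injOn) W
  calc _ ≤ ∫⁻ p in gset g, ENNReal.ofReal |(blk (fderiv ℝ g p.1) (fderiv ℝ g p.2) κ κ).det| * W (GG g κ κ p) := by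
        refine lintegral_mono fun p => ?_
        rw [blk_det]
        have e : ‖ff g (κ : ℂ) p‖ = |(1 - (κ * κ) • mat ((fderiv ℝ g p.2).comp (fderiv ℝ g p.1))).det| *
            Real.exp (-(SS p - κ ^ 2 * TT g p)) := by
          unfold ff
          rw [show ((κ : ℂ)) ^ 2 = ((κ * κ : ℝ) : ℂ) by push_cast; ring, cdet_ofReal, norm_mul,
            Complex.norm_real, Complex.norm_exp, mul_comm, Real.norm_eq_abs]
          congr 2
          simp [pow_two]
        rw [← ofReal_norm, e, ENNReal.ofReal_mul (abs_nonneg _)]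
        gcongr
        exact hW p
    _ = ∫⁻ q in GG g κ κ '' gset g, W q := h2.symm
    _ ≤ _ := setLIntegral_le_lintegral _ _

/-- proximal map -/
theorem exists_prox {N : E → ℝ} (hc : Continuous N) (hn : ∀ x, 0 ≤ N x)
    (hadd : ∀ x y, N (x + y) ≤ N x + N y) (hsm : ∀ (t : ℝ) x, 0 ≤ t → N (t • x) = t * N x) (w : E) :
    ∃ x : E, ∀ z, N x ^ 2 + 2 * ⟪w - x, z - x⟫ ≤ N z ^ 2 := by
  have : ProperSpace E := FiniteDimensional.proper ℝ _
  obtain ⟨x, hx⟩ : ∃ x, ∀ z, N x ^ 2 + ‖x - w‖ ^ 2 ≤ N z ^ 2 + ‖z - w‖ ^ 2 := by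
    refine Continuous.exists_forall_le (by fun_prop) ?_
    have h1 : Filter.Tendsto (fun z : E => ‖z - w‖) (Filter.cocompact E) Filter.atTop := by
      have := tendsto_norm_cocompact_atTop (E := E)
      refine Filter.tendsto_atTop_mono (fun z => ?_) (Filter.tendsto_atTop_add_const_right _ (-‖w‖) this)
      have := norm_sub_norm_le z w
      linarith
    have h2 := (Filter.tendsto_pow_atTop (α := ℝ) two_ne_zero).comp h1
    exact Filter.tendsto_atTop_mono (fun z => le_add_of_nonneg_left (sq_nonneg _)) h2
  refine ⟨x, fun z => ?_⟩
  have key : ∀ t : ℝ, 0 < t → t ≤ 1 → N x ^ 2 + 2 * ⟪w - x, z - x⟫ - t * ‖z - x‖ ^ 2 ≤ N z ^ 2 := by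
    intro t ht ht1
    have h := hx ((1 - t) • x + t • z)
    have hN : N ((1 - t) • x + t • z) ≤ (1 - t) * N x + t * N z := by
      refine (hadd _ _).trans ?_
      rw [hsm _ _ (by linarith), hsm _ _ ht.le]
    have hN2 : N ((1 - t) • x + t • z) ^ 2 ≤ (1 - t) * N x ^ 2 + t * N z ^ 2 := by
      calc N ((1 - t) • x + t • z) ^ 2 ≤ ((1 - t) * N x + t * N z) ^ 2 :=
            pow_le_pow_left₀ (hn _) hN 2
        _ ≤ _ := by nlinarith [mul_nonneg (mul_nonneg ht.le (sub_nonneg.2 ht1)) (sq_nonneg (N x - N z))]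
    have hnorm : ‖(1 - t) • x + t • z - w‖ ^ 2 = ‖x - w‖ ^ 2 - 2 * t * ⟪w - x, z - x⟫ + t ^ 2 * ‖z - x‖ ^ 2 := by
      have e : (1 - t) • x + t • z - w = t • (z - x) - (w - x) := by
        rw [sub_smul, one_smul, smul_sub]; abel
      rw [e, norm_sub_sq_real, inner_smul_left, norm_smul, mul_pow, Real.norm_eq_abs, sq_abs,
        real_inner_comm, norm_sub_rev w x]
      simp; ring
    rw [hnorm] at h
    have : t * (N x ^ 2 + 2 * ⟪w - x, z - x⟫ - t * ‖z - x‖ ^ 2) ≤ t * N z ^ 2 := by nlinarith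
    exact le_of_mul_le_mul_left this ht
  by_contra hcon
  push Not at hcon
  set A := N x ^ 2 + 2 * ⟪w - x, z - x⟫ - N z ^ 2 with hA
  have hApos : 0 < A := by rw [hA]; linarith
  have hB : 0 < ‖z - x‖ ^ 2 + A + 1 := by positivity
  have h := key (A / (‖z - x‖ ^ 2 + A + 1)) (by positivity) (by rw [div_le_one hB]; nlinarith [sq_nonneg ‖z - x‖])
  have : A / (‖z - x‖ ^ 2 + A + 1) * ‖z - x‖ ^ 2 < A := by
    rw [div_mul_eq_mul_div, div_lt_iff₀ hB]
    nlinarith [sq_nonneg ‖z - x‖]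
  linarith

theorem bm_func {N N' : E → ℝ} (hc : Continuous N) (hn : ∀ x, 0 ≤ N x)
    (hadd : ∀ x y, N (x + y) ≤ N x + N y) (hsm : ∀ (t : ℝ) x, 0 ≤ t → N (t • x) = t * N x)
    (hn' : ∀ x, 0 ≤ N' x)
    (hadd' : ∀ x y, N' (x + y) ≤ N' x + N' y) (hsm' : ∀ (t : ℝ) x, 0 ≤ t → N' (t • x) = t * N' x)
    (hneg' : ∀ x, N' (-x) = N' x)
    (hdual : ∀ y a, 0 ≤ a → (∀ z, N z ≤ 1 → ⟪y, z⟫ ≤ a) → N' y ≤ a)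
    (R : ℝ) (hR : ∀ x, N x ≤ R * N' x) (hR' : ∀ x, N' x ≤ R * N x) :
    ENNReal.ofReal (Real.pi ^ (Module.finrank ℝ E)) ≤
      ∫⁻ q : E × E, ENNReal.ofReal (Real.exp (-((N (q.1 + q.2)) ^ 2 + (N' (q.1 - q.2)) ^ 2) / 16)) := by
  choose P hP using fun u : E => exists_prox hc hn hadd hsm ((2 : ℝ) • u)
  let g : E → E := fun u => P u - u
  have hx : ∀ u, u + g u = P u := fun u => by simp [g]
  have hy : ∀ u, u - g u = (2 : ℝ) • u - P u := fun u => by simp only [g, two_smul]; abel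
  have hsub : ∀ u z, N (u + g u) ^ 2 + 2 * ⟪u - g u, z - (u + g u)⟫ ≤ N z ^ 2 := by
    intro u z; rw [hx, hy]; exact hP u z
  have hxy : ∀ u, ⟪u + g u, u - g u⟫ = N (u + g u) ^ 2 := by
    intro u
    set x := u + g u with hxdef
    set y := u - g u with hydef
    have hs : ∀ s : ℝ, 0 ≤ s → N x ^ 2 + 2 * ((s - 1) * ⟪x, y⟫) ≤ s ^ 2 * N x ^ 2 := by
      intro s hs
      have := hsub u (s • x)
      rw [← hxdef, ← hydef, hsm s x hs, mul_pow, show s • x - x = (s - 1) • x by rw [sub_smul, one_smul],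
        inner_smul_right, real_inner_comm] at this
      exact this
    refine le_antisymm ?_ ?_
    · by_contra hcon
      push Not at hcon
      -- s = 1 + t
      have h1 : ∀ t : ℝ, 0 < t → 2 * (⟪x, y⟫ - N x ^ 2) ≤ t * N x ^ 2 := by
        intro t ht
        have := hs (1 + t) (by linarith)
        have : t * (2 * (⟪x, y⟫ - N x ^ 2)) ≤ t * (t * N x ^ 2) := by nlinarith
        exact le_of_mul_le_mul_left this ht
      set D := ⟪x, y⟫ - N x ^ 2 with hD
      have hD0 : 0 < D := by rw [hD]; linarith
      have := h1 (D / (N x ^ 2 + 1)) (by positivity)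
      have h2 : D / (N x ^ 2 + 1) * N x ^ 2 < D := by
        rw [div_mul_eq_mul_div, div_lt_iff₀ (by positivity)]; nlinarith
      linarith
    · by_contra hcon
      push Not at hcon
      have h1 : ∀ t : ℝ, 0 < t → t ≤ 1 → 2 * (N x ^ 2 - ⟪x, y⟫) ≤ t * N x ^ 2 := by
        intro t ht ht1
        have := hs (1 - t) (by linarith)
        have : t * (2 * (N x ^ 2 - ⟪x, y⟫)) ≤ t * (t * N x ^ 2) := by nlinarith
        exact le_of_mul_le_mul_left this ht
      set D := N x ^ 2 - ⟪x, y⟫ with hD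
      have hD0 : 0 < D := by rw [hD]; linarith
      have hB : 0 < N x ^ 2 + D + 1 := by positivity
      have := h1 (D / (N x ^ 2 + D + 1)) (by positivity) (by rw [div_le_one hB]; nlinarith [sq_nonneg (N x)])
      have h2 : D / (N x ^ 2 + D + 1) * N x ^ 2 < D := by
        rw [div_mul_eq_mul_div, div_lt_iff₀ hB]; nlinarith [sq_nonneg (N x)]
      linarith
  have hyN : ∀ u, N' (u - g u) ≤ N (u + g u) := by
    intro u
    refine hdual _ _ (hn _) fun z hz => ?_
    have h2 : ∀ s : ℝ, 0 ≤ s → 2 * (s * ⟪u - g u, z⟫) ≤ s ^ 2 + N (u + g u) ^ 2 := by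
      intro s hs
      have := hsub u (s • z)
      rw [hsm s z hs, inner_sub_right, inner_smul_right, real_inner_comm, real_inner_comm (u + g u), hxy] at this
      have h3 : (s * N z) ^ 2 ≤ s ^ 2 := by
        rw [mul_pow]; exact mul_le_of_le_one_right (sq_nonneg _) (by nlinarith [hn z])
      rw [real_inner_comm (u - g u) z] at this
      nlinarith
    rcases (hn (u + g u)).eq_or_lt with h | h
    · by_contra hcon
      rw [← h] at hcon h2
      push Not at hcon
      have := h2 _ hcon.le
      nlinarith
    · have := h2 _ h.le
      nlinarith
  have hg : LipschitzWith 1 g := by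
    refine LipschitzWith.of_dist_le_mul fun u u' => ?_
    rw [dist_eq_norm, dist_eq_norm, NNReal.coe_one, one_mul]
    have a1 := hsub u (u' + g u')
    have a2 := hsub u' (u + g u)
    have e1 : u' + g u' - (u + g u) = -((u - u') + (g u - g u')) := by abel
    have e2 : u + g u - (u' + g u') = (u - u') + (g u - g u') := by abel
    rw [e1, inner_neg_right] at a1
    rw [e2] at a2
    have a3 : 0 ≤ ⟪(u - g u) - (u' - g u'), (u - u') + (g u - g u')⟫ := by
      rw [inner_sub_left]; linarith
    rw [show (u - g u) - (u' - g u') = (u - u') - (g u - g u') by abel] at a3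
    rw [inner_sub_left, inner_add_right, inner_add_right, real_inner_self_eq_norm_sq,
      real_inner_self_eq_norm_sq, real_inner_comm (u - u') (g u - g u')] at a3
    exact pow_le_pow_iff_left₀ (norm_nonneg _) (norm_nonneg _) two_ne_zero |>.1 (by linarith)
  have h0 : g 0 = 0 := by
    have := hxy 0
    rw [zero_add, zero_sub, inner_neg_right, real_inner_self_eq_norm_sq] at this
    have : ‖g 0‖ ^ 2 = 0 := by nlinarith [sq_nonneg ‖g 0‖, sq_nonneg (N (g 0))]
    simpa using this
  -- choose κ
  let β : ℝ := 1 / (2 + |R|)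
  have hβ0 : 0 < β := by positivity
  have hβ1 : β ≤ 1 / 2 := by
    apply one_div_le_one_div_of_le (by norm_num); linarith [abs_nonneg R]
  have hβR : β * |R| ≤ 1 := by
    change 1 / (2 + |R|) * |R| ≤ 1
    rw [div_mul_eq_mul_div, div_le_one (by positivity)]; linarith
  have hκ0 : 0 ≤ 1 - 2 * β := by linarith
  refine cov_bound hg h0 hκ0 (by linarith : 1 - 2 * β < 1) _ fun p => ?_
  have est : ∀ u, N (u + (1 - 2 * β) • g u) ≤ 2 * N (u + g u) ∧ N' (u - (1 - 2 * β) • g u) ≤ 2 * N (u + g u) := by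
    intro u
    have e1 : u + (1 - 2 * β) • g u = (1 - β) • (u + g u) + β • (u - g u) := by module
    have e2 : u - (1 - 2 * β) • g u = (1 - β) • (u - g u) + β • (u + g u) := by module
    have b1 : N (u - g u) ≤ |R| * N (u + g u) :=
      (hR _).trans ((mul_le_mul_of_nonneg_right (le_abs_self R) (hn' _)).trans
        (mul_le_mul_of_nonneg_left (hyN u) (abs_nonneg R)))
    have b2 : N' (u + g u) ≤ |R| * N (u + g u) :=
      (hR' _).trans (mul_le_mul_of_nonneg_right (le_abs_self R) (hn _))
    have hnn := hn (u + g u)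
    have c1 : β * (|R| * N (u + g u)) ≤ N (u + g u) := by
      rw [← mul_assoc]; exact mul_le_of_le_one_left hnn hβR
    rw [e1, e2]
    constructor
    · refine (hadd _ _).trans ?_
      rw [hsm _ _ (by linarith), hsm _ _ hβ0.le]
      nlinarith [mul_le_mul_of_nonneg_left b1 hβ0.le]
    · refine (hadd' _ _).trans ?_
      rw [hsm' _ _ (by linarith), hsm' _ _ hβ0.le]
      nlinarith [mul_le_mul_of_nonneg_left b2 hβ0.le, hyN u]
  apply ENNReal.ofReal_le_ofReal
  apply Real.exp_le_exp.2
  obtain ⟨u, v⟩ := p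
  obtain ⟨p1, p2⟩ := est u
  obtain ⟨q1, q2⟩ := est v
  simp only [GG, SS, TT]
  set κ := 1 - 2 * β
  have s1 : u + κ • g v + (v + κ • g u) = (u + κ • g u) + (v + κ • g v) := by abel
  have s2 : u + κ • g v - (v + κ • g u) = (u - κ • g u) + -(v - κ • g v) := by abel
  rw [s1, s2]
  have t1 := (hadd (u + κ • g u) (v + κ • g v)).trans (add_le_add p1 q1)
  have t2 := (hadd' (u - κ • g u) (-(v - κ • g v))).trans (add_le_add p2 ((hneg' _).le.trans q2))
  have n1 : ‖u‖ ^ 2 - ‖g u‖ ^ 2 = N (u + g u) ^ 2 := by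
    rw [← hxy, inner_sub_right, inner_add_left, inner_add_left, real_inner_self_eq_norm_sq,
      real_inner_self_eq_norm_sq, real_inner_comm u (g u)]; ring
  have n2 : ‖v‖ ^ 2 - ‖g v‖ ^ 2 = N (v + g v) ^ 2 := by
    rw [← hxy, inner_sub_right, inner_add_left, inner_add_left, real_inner_self_eq_norm_sq,
      real_inner_self_eq_norm_sq, real_inner_comm v (g v)]; ring
  have k1 : κ ^ 2 ≤ 1 := by
    have : κ ≤ 1 := by simp only [κ]; linarith
    nlinarith
  have w1 := pow_le_pow_left₀ (hn _) t1 2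
  have w2 := pow_le_pow_left₀ (hn' _) t2 2
  have k2 : κ ^ 2 * (‖g v‖ ^ 2 + ‖g u‖ ^ 2) ≤ ‖g v‖ ^ 2 + ‖g u‖ ^ 2 :=
    mul_le_of_le_one_left (by positivity) k1
  nlinarith [sq_nonneg (N (u + g u) - N (v + g v))]
end Up
end BM

namespace BM
open scoped Pointwise

section Up5
variable {E : Type*} [NormedAddCommGroup E] [InnerProductSpace ℝ E] [FiniteDimensional ℝ E]
  [MeasurableSpace E] [BorelSpace E]

theorem gauss_vol {N : E → ℝ} (h1 : N 0 = 0) (h2 : ∀ x, N (-x) = N x)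
    (h3 : ∀ x y, N (x + y) ≤ N x + N y) (h4 : ∀ {x}, N x = 0 → x = 0)
    (hsm : ∀ (t : ℝ) x, 0 ≤ t → N (t • x) = t * N x)
    (hv : volume {x | N x < 1} ≠ 0) {s : ℝ} (hs : 0 < s) :
    ∫⁻ x, ENNReal.ofReal (Real.exp (-(N x / s) ^ 2)) ≤
      ENNReal.ofReal (s ^ (Module.finrank ℝ E) * Real.Gamma ((Module.finrank ℝ E : ℝ) / 2 + 1)) * volume {x | N x < 1} := by
  have key := measure_lt_one_eq_integral_div_gamma (volume : Measure E) (g := fun x => N x / s)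
    (by simp [h1]) (by intro x; simp [h2])
    (by intro x y; rw [← add_div]; exact div_le_div_of_nonneg_right (h3 x y) hs.le)
    (by intro x hx; apply h4; rcases div_eq_zero_iff.1 hx with h | h; exact h; exact absurd h hs.ne')
    (by
      intro r x
      rw [← mul_div_assoc]
      refine div_le_div_of_nonneg_right ?_ hs.le
      rcases le_total 0 r with h | h
      · rw [abs_of_nonneg h, hsm _ _ h]
      · rw [abs_of_nonpos h, ← hsm _ _ (by linarith), neg_smul, h2]) (p := 2) two_pos
  have hset : {x : E | N x / s < 1} = s • {x | N x < 1} := by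
    ext x
    rw [Set.mem_smul_set_iff_inv_smul_mem₀ hs.ne']
    change N x / s < 1 ↔ N (s⁻¹ • x) < 1
    rw [hsm _ _ (by positivity)]; rw [div_eq_inv_mul]
  rw [hset, Measure.addHaar_smul, abs_of_pos (by positivity)] at key
  have hG : 0 < Real.Gamma ((Module.finrank ℝ E : ℝ) / 2 + 1) := Real.Gamma_pos_of_pos (by positivity)
  have hnz0 : (∫ x : E, Real.exp (-(N x / s) ^ (2 : ℝ))) ≠ 0 := by
    intro h
    rw [h] at key
    simp only [zero_div, ENNReal.ofReal_zero, mul_eq_zero, hv, or_false, ENNReal.ofReal_eq_zero] at key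
    exact absurd key (by push Not; positivity)
  have hI : Integrable (fun x : E => Real.exp (-(N x / s) ^ (2 : ℝ))) := by
    by_contra h; exact hnz0 (integral_undef h)
  have e : ∀ x, ENNReal.ofReal (Real.exp (-(N x / s) ^ 2)) = ENNReal.ofReal (Real.exp (-(N x / s) ^ (2 : ℝ))) := by
    intro x; rw [Real.rpow_two]
  simp_rw [e]
  rw [← ofReal_integral_eq_lintegral_ofReal hI (Filter.Eventually.of_forall fun x => (Real.exp_pos _).le)]
  rw [mul_comm (s ^ _), ENNReal.ofReal_mul hG.le, mul_assoc, key, ← ENNReal.ofReal_mul hG.le]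
  apply le_of_eq; congr 1; field_simp

theorem bm_vol {N N' : E → ℝ} (hc : Continuous N) (hc' : Continuous N') (hn : ∀ x, 0 ≤ N x)
    (hadd : ∀ x y, N (x + y) ≤ N x + N y) (hsm : ∀ (t : ℝ) x, 0 ≤ t → N (t • x) = t * N x)
    (hneg : ∀ x, N (-x) = N x) (h0 : ∀ x, N x = 0 → x = 0)
    (hn' : ∀ x, 0 ≤ N' x)
    (hadd' : ∀ x y, N' (x + y) ≤ N' x + N' y) (hsm' : ∀ (t : ℝ) x, 0 ≤ t → N' (t • x) = t * N' x)
    (hneg' : ∀ x, N' (-x) = N' x) (h0' : ∀ x, N' x = 0 → x = 0)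
    (hdual : ∀ y a, 0 ≤ a → (∀ z, N z ≤ 1 → ⟪y, z⟫ ≤ a) → N' y ≤ a)
    (R : ℝ) (hR : ∀ x, N x ≤ R * N' x) (hR' : ∀ x, N' x ≤ R * N x)  :
    ENNReal.ofReal (Real.pi ^ (Module.finrank ℝ E)) ≤
      ENNReal.ofReal (8 ^ (Module.finrank ℝ E) * Real.Gamma ((Module.finrank ℝ E : ℝ) / 2 + 1) ^ 2) *
        (volume {x | N x < 1} * volume {x | N' x < 1}) := by
  have z : N 0 = 0 := by simpa using hsm 0 0 le_rfl
  have z' : N' 0 = 0 := by simpa using hsm' 0 0 le_rfl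
  have hv : volume {x | N x < 1} ≠ 0 :=
    ((isOpen_lt hc continuous_const).measure_pos _ ⟨0, by change N 0 < 1; rw [z]; norm_num⟩).ne'
  have hv' : volume {x | N' x < 1} ≠ 0 :=
    ((isOpen_lt hc' continuous_const).measure_pos _ ⟨0, by change N' 0 < 1; rw [z']; norm_num⟩).ne'
  have a1 := gauss_vol z hneg hadd (h0 _) hsm hv (s := 4) (by norm_num)
  have a2 := gauss_vol z' hneg' hadd' (h0' _) hsm' hv' (s := 2) (by norm_num)
  have b := bm_func hc hn hadd hsm hn' hadd' hsm' hneg' hdual R hR hR'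
  refine b.trans ?_
  have e : ∀ q : E × E, ENNReal.ofReal (Real.exp (-((N (q.1 + q.2)) ^ 2 + (N' (q.1 - q.2)) ^ 2) / 16))
      = ENNReal.ofReal (Real.exp (-(N (q.1 + q.2) / 4) ^ 2)) * ENNReal.ofReal (Real.exp (-(N' (q.1 - q.2) / 4) ^ 2)) := by
    intro q
    rw [← ENNReal.ofReal_mul (Real.exp_pos _).le, ← Real.exp_add]; congr 2; ring
  simp_rw [e]
  rw [Measure.volume_eq_prod, lintegral_prod _ (by fun_prop)]
  have e2 : ∀ u : E, ∫⁻ v, ENNReal.ofReal (Real.exp (-(N (u + v) / 4) ^ 2)) * ENNReal.ofReal (Real.exp (-(N' (u - v) / 4) ^ 2))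
      = ∫⁻ w, ENNReal.ofReal (Real.exp (-(N w / 4) ^ 2)) * ENNReal.ofReal (Real.exp (-(N' (u + (u - w)) / 4) ^ 2)) := by
    intro u
    rw [← lintegral_add_left_eq_self (fun w => ENNReal.ofReal (Real.exp (-(N w / 4) ^ 2)) * ENNReal.ofReal (Real.exp (-(N' (u + (u - w)) / 4) ^ 2))) u]
    congr 1; ext v
    rw [show u + (u - (u + v)) = u - v by abel]
  simp_rw [e2]
  rw [lintegral_lintegral_swap (by fun_prop)]
  have e3 : ∀ w : E, ∫⁻ u, ENNReal.ofReal (Real.exp (-(N w / 4) ^ 2)) * ENNReal.ofReal (Real.exp (-(N' (u + (u - w)) / 4) ^ 2))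
      = ENNReal.ofReal (Real.exp (-(N w / 4) ^ 2)) * ∫⁻ u, ENNReal.ofReal (Real.exp (-(N' u / 2) ^ 2)) := by
    intro w
    rw [lintegral_const_mul _ (by fun_prop)]
    congr 1
    rw [← lintegral_sub_right_eq_self (fun u => ENNReal.ofReal (Real.exp (-(N' u / 2) ^ 2))) ((2 : ℝ)⁻¹ • w)]
    congr 1; ext u; congr 4
    rw [show u + (u - w) = (2 : ℝ) • (u - (2 : ℝ)⁻¹ • w) by module, hsm' _ _ two_pos.le]; ring
  simp_rw [e3]
  rw [lintegral_mul_const _ (by fun_prop)]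
  refine (mul_le_mul' a1 a2).trans (le_of_eq ?_)
  rw [mul_mul_mul_comm, ← ENNReal.ofReal_mul (by have := Real.Gamma_pos_of_pos (s := (Module.finrank ℝ E : ℝ) / 2 + 1) (by positivity); positivity)]
  congr 2
  rw [show (8 : ℝ) = 4 * 2 by norm_num, mul_pow]; ring
end Up5

theorem gamma_bound (d : ℕ) : Real.Gamma ((d : ℝ) / 2 + 1) ^ 2 ≤ (d : ℝ) ^ d := by
  have h := Real.Gamma_mul_add_mul_le_rpow_Gamma_mul_rpow_Gamma (s := 1) (t := (d : ℝ) + 1) (a := 1 / 2) (b := 1 / 2)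
    one_pos (by positivity) (by norm_num) (by norm_num) (by norm_num)
  rw [Real.Gamma_one, Real.one_rpow, one_mul, Real.Gamma_nat_eq_factorial,
    show (1 / 2 * 1 + 1 / 2 * ((d : ℝ) + 1)) = (d : ℝ) / 2 + 1 by ring] at h
  have h2 := pow_le_pow_left₀ (Real.Gamma_pos_of_pos (by positivity)).le h 2
  rw [← Real.rpow_natCast (_ ^ (_ : ℝ)), ← Real.rpow_mul (by positivity)] at h2
  norm_num at h2
  refine h2.trans ?_
  exact_mod_cast Nat.factorial_le_pow d

theorem bm_sym {d : ℕ} {L : Set (EuclideanSpace ℝ (Fin d))} (hL : IsCompact L) (hcv : Convex ℝ L)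
    (hs : ∀ x ∈ L, -x ∈ L) (h0 : (0 : EuclideanSpace ℝ (Fin d)) ∈ interior L) :
    ENNReal.ofReal (8⁻¹ ^ d) ≤ ENNReal.ofReal ((d : ℝ) ^ d) * (volume L * volume (polarBody L)) := by
  have hLn : L ∈ nhds (0 : EuclideanSpace ℝ (Fin d)) := mem_interior_iff_mem_nhds.1 h0
  obtain ⟨r, hr, hball⟩ := Metric.mem_nhds_iff.1 hLn
  obtain ⟨M, hM⟩ := hL.isBounded.exists_norm_le
  let M' := max M 1
  have hM' : ∀ x ∈ L, ‖x‖ ≤ M' := fun x hx => (hM x hx).trans (le_max_left _ _)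
  have hMp : 0 < M' := lt_of_lt_of_le one_pos (le_max_right _ _)
  have pc : Convex ℝ (polarBody L) := by
    intro x hx y hy a b ha hb hab z hz
    rw [inner_add_right, inner_smul_right, inner_smul_right]
    nlinarith [hx z hz, hy z hz]
  have ps : ∀ x ∈ polarBody L, -x ∈ polarBody L := by
    intro x hx z hz
    have := hx (-z) (hs z hz)
    simpa [inner_neg_left, inner_neg_right] using this
  have pball : Metric.ball 0 (M'⁻¹) ⊆ polarBody L := by
    intro y hy z hz
    have hy' : ‖y‖ < M'⁻¹ := by simpa using hy
    refine (real_inner_le_norm _ _).trans ?_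
    calc ‖z‖ * ‖y‖ ≤ M' * M'⁻¹ := mul_le_mul (hM' z hz) hy'.le (norm_nonneg _) hMp.le
      _ = 1 := mul_inv_cancel₀ hMp.ne'
  have pn : polarBody L ∈ nhds (0 : EuclideanSpace ℝ (Fin d)) :=
    Filter.mem_of_superset (Metric.ball_mem_nhds _ (by positivity)) pball
  have pbd : polarBody L ⊆ Metric.closedBall 0 (2 / r) := by
    intro y hy
    rw [mem_closedBall_zero_iff]
    by_cases hy0 : y = 0
    · simp [hy0]; positivity
    have hyp : 0 < ‖y‖ := norm_pos_iff.2 hy0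
    have := hy ((r / 2 / ‖y‖) • y) (hball (by
      rw [mem_ball_zero_iff, norm_smul, Real.norm_of_nonneg (by positivity), div_mul_cancel₀ _ hyp.ne']; linarith))
    rw [inner_smul_left, real_inner_self_eq_norm_sq] at this
    simp only [conj_trivial] at this
    rw [show r / 2 / ‖y‖ * ‖y‖ ^ 2 = r / 2 * ‖y‖ by field_simp] at this
    rw [le_div_iff₀ hr]; linarith
  have aL : Absorbent ℝ L := absorbent_nhds_zero hLn
  have aP : Absorbent ℝ (polarBody L) := absorbent_nhds_zero pn
  have l1 : ∀ x, gauge L x ≤ ‖x‖ / r := fun x => by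
    have := gauge_mono (absorbent_ball_zero (𝕜 := ℝ) hr) hball x
    rwa [gauge_ball hr.le] at this
  have l2 : ∀ x, ‖x‖ / M' ≤ gauge L x := fun x => by
    have := gauge_mono aL (t := Metric.closedBall 0 M') (fun x hx => by simpa using hM' x hx) x
    rwa [gauge_closedBall hMp.le] at this
  have l1' : ∀ x, gauge (polarBody L) x ≤ ‖x‖ / M'⁻¹ := fun x => by
    have := gauge_mono (absorbent_ball_zero (𝕜 := ℝ) (inv_pos.2 hMp)) pball x
    rwa [gauge_ball (inv_pos.2 hMp).le] at this
  have l2' : ∀ x, ‖x‖ / (2 / r) ≤ gauge (polarBody L) x := fun x => by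
    have := gauge_mono aP pbd x
    rwa [gauge_closedBall (by positivity)] at this
  have gz : ∀ x, gauge L x = 0 → x = 0 := fun x hx => by
    have := l2 x; rw [hx, div_le_iff₀ hMp, zero_mul] at this; simpa using this
  have gz' : ∀ x, gauge (polarBody L) x = 0 → x = 0 := fun x hx => by
    have := l2' x; rw [hx, div_le_iff₀ (by positivity), zero_mul] at this; simpa using this
  have key := bm_vol (N := gauge L) (N' := gauge (polarBody L)) (continuous_gauge hcv hLn)
    (continuous_gauge pc pn) gauge_nonneg (gauge_add_le hcv aL)
    (fun t x ht => by rw [gauge_smul_of_nonneg ht, smul_eq_mul]) (gauge_neg hs) gz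
    gauge_nonneg (gauge_add_le pc aP)
    (fun t x ht => by rw [gauge_smul_of_nonneg ht, smul_eq_mul]) (gauge_neg ps) gz'
    (by
      intro y a ha h
      refine le_of_forall_pos_le_add fun δ hδ => ?_
      have hb : 0 < a + δ := by linarith
      refine gauge_le_of_mem hb.le ?_
      rw [Set.mem_smul_set_iff_inv_smul_mem₀ hb.ne']
      intro z hz
      have := h z (gauge_le_one_of_mem hz)
      rw [inner_smul_right, real_inner_comm, inv_mul_le_iff₀ hb]; linarith)
    (2 / r ^ 2 + M' ^ 2)
    (by
      intro x
      refine (l1 x).trans ?_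
      have h := l2' x
      rw [div_le_iff₀ (by positivity)] at h
      rw [div_le_iff₀ hr]
      have : (0 : ℝ) ≤ M' ^ 2 * gauge (polarBody L) x * r := by have := gauge_nonneg (s := polarBody L) x; positivity
      have e : 2 / r ^ 2 * gauge (polarBody L) x * r = gauge (polarBody L) x * (2 / r) := by field_simp
      linarith)
    (by
      intro x
      refine (l1' x).trans ?_
      have h := l2 x
      rw [div_le_iff₀ hMp] at h
      rw [div_inv_eq_mul]
      have : (0 : ℝ) ≤ 2 / r ^ 2 * gauge L x := by have := gauge_nonneg (s := L) x; positivity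
      nlinarith)
  rw [finrank_euclideanSpace_fin] at key
  have s1 : {x | gauge L x < 1} ⊆ L := setOfPred_gauge_lt_one_subset_self hcv (mem_of_mem_nhds hLn) aL
  have s2 : {x | gauge (polarBody L) x < 1} ⊆ polarBody L := setOfPred_gauge_lt_one_subset_self pc (mem_of_mem_nhds pn) aP
  have key2 := key.trans (mul_le_mul' (ENNReal.ofReal_le_ofReal (mul_le_mul_of_nonneg_left (gamma_bound d) (by positivity : (0 : ℝ) ≤ 8 ^ d)))
    (mul_le_mul' (measure_mono s1) (measure_mono s2)))
  rw [ENNReal.ofReal_mul (by positivity), mul_assoc] at key2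
  have p1 : ENNReal.ofReal 1 ≤ ENNReal.ofReal (Real.pi ^ d) :=
    ENNReal.ofReal_le_ofReal (one_le_pow₀ (by linarith [Real.pi_gt_three]))
  have key3 := mul_le_mul' (le_refl (ENNReal.ofReal (8⁻¹ ^ d))) (p1.trans key2)
  rw [← mul_assoc, ← ENNReal.ofReal_mul (by positivity), ← ENNReal.ofReal_mul (by positivity), ← mul_pow,
    inv_mul_cancel₀ (by norm_num), one_pow, mul_one, ENNReal.ofReal_one, one_mul] at key3
  exact key3
end BM

namespace BM
open scoped Pointwise

theorem rs_weak {d : ℕ} {P : Set (EuclideanSpace ℝ (Fin d))} (hP : IsCompact P) (hcv : Convex ℝ P)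
    (h0 : volume P ≠ 0) : volume (P - P) ≤ ENNReal.ofReal (4 ^ d) * volume P := by
  let f : EuclideanSpace ℝ (Fin d) → ℝ≥0∞ := P.indicator 1
  have hPm : MeasurableSet P := hP.isClosed.measurableSet
  have hf : Measurable f := measurable_one.indicator hPm
  have hfP : ∫⁻ x, f x = volume P := by simp only [f]; rw [lintegral_indicator_one hPm]
  have htop : volume P ≠ ⊤ := hP.measure_lt_top.ne
  have e1 : ∫⁻ z, ∫⁻ x, f x * f (x - z) = volume P * volume P := by
    rw [lintegral_lintegral_swap (by fun_prop)]
    have : ∀ x, ∫⁻ z, f x * f (x - z) = f x * volume P := by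
      intro x
      rw [lintegral_const_mul _ (by fun_prop), lintegral_sub_left_eq_self f x, hfP]
    simp_rw [this]
    rw [lintegral_mul_const _ hf, hfP]
  have hH : MeasurableSet ((1 / 2 : ℝ) • (P - P)) := by
    rw [sub_eq_add_neg]; exact ((hP.add hP.neg).smul _).isClosed.measurableSet
  have e2 : ∀ z ∈ (1 / 2 : ℝ) • (P - P), ENNReal.ofReal ((1 / 2) ^ d) * volume P ≤ ∫⁻ x, f x * f (x - z) := by
    rintro z ⟨w, ⟨a, ha, b, hb, rfl⟩, rfl⟩
    have hsub : (fun x => (1 / 2 : ℝ) • a + x) '' ((1 / 2 : ℝ) • P) ⊆ {x | x ∈ P ∧ x - (1 / 2 : ℝ) • (a - b) ∈ P} := by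
      rintro _ ⟨_, ⟨p, hp, rfl⟩, rfl⟩
      refine ⟨hcv ha hp (by norm_num) (by norm_num) (by norm_num), ?_⟩
      have := hcv hb hp (a := 1 / 2) (b := 1 / 2) (by norm_num) (by norm_num) (by norm_num)
      convert this using 1
      module
    have h1 : volume ((fun x => (1 / 2 : ℝ) • a + x) '' ((1 / 2 : ℝ) • P)) = ENNReal.ofReal ((1 / 2) ^ d) * volume P := by
      rw [Set.image_add_left, measure_preimage_add, Measure.addHaar_smul, finrank_euclideanSpace_fin, abs_of_pos (by positivity)]
    rw [← h1]
    refine (measure_mono hsub).trans ?_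
    have hm : MeasurableSet {x | x ∈ P ∧ x - (1 / 2 : ℝ) • (a - b) ∈ P} :=
      hPm.inter (hPm.preimage (measurable_id.sub_const _))
    rw [← lintegral_indicator_one hm]
    refine lintegral_mono fun x => ?_
    by_cases hx : x ∈ {x | x ∈ P ∧ x - (1 / 2 : ℝ) • (a - b) ∈ P}
    · rw [Set.indicator_of_mem hx]
      simp only [f]
      rw [Set.indicator_of_mem hx.1]
      beta_reduce
      rw [Set.indicator_of_mem hx.2]; simp
    · rw [Set.indicator_of_notMem hx]; exact zero_le
  have e3 : ENNReal.ofReal ((1 / 2) ^ d) * volume P * volume ((1 / 2 : ℝ) • (P - P)) ≤ volume P * volume P := by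
    rw [← e1, ← setLIntegral_const]
    refine (setLIntegral_mono' hH e2).trans (setLIntegral_le_lintegral _ _)
  rw [Measure.addHaar_smul, finrank_euclideanSpace_fin, abs_of_pos (by positivity)] at e3
  have e4 : volume P * (ENNReal.ofReal ((1 / 2) ^ d) * ENNReal.ofReal ((1 / 2) ^ d) * volume (P - P)) ≤ volume P * volume P := by
    refine le_trans (le_of_eq ?_) e3; ring
  rw [ENNReal.mul_le_mul_iff_right h0 htop, ← ENNReal.ofReal_mul (by positivity)] at e4
  have := mul_le_mul' (le_refl (ENNReal.ofReal (4 ^ d))) e4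
  rw [← mul_assoc, ← ENNReal.ofReal_mul (by positivity), ← mul_pow, ← mul_pow] at this
  norm_num at this
  simpa using this
end BM

namespace BM
open scoped Pointwise

section Cap
variable {d : ℕ} {K : Set (EuclideanSpace ℝ (Fin d))}

theorem gauge_pos' (hK : IsCompact K) (h0 : (0 : EuclideanSpace ℝ (Fin d)) ∈ interior K)
    {y : EuclideanSpace ℝ (Fin d)} (hy : y ≠ 0) : 0 < gauge K y :=
  (gauge_pos (absorbent_nhds_zero (mem_interior_iff_mem_nhds.1 h0))
    (NormedSpace.isVonNBounded_of_isBounded _ hK.isBounded)).2 hy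

theorem ray (hK : IsCompact K) (hc : Convex ℝ K) (h0 : (0 : EuclideanSpace ℝ (Fin d)) ∈ interior K)
    {y : EuclideanSpace ℝ (Fin d)} (hyK : y ∈ K) (hy : y ≠ 0) : ∃ l : ℝ, 1 ≤ l ∧ l • y ∈ frontier K := by
  have hg := gauge_pos' hK h0 hy
  refine ⟨(gauge K y)⁻¹, (one_le_inv₀ hg).2 (gauge_le_one_of_mem hyK), ?_⟩
  rw [← gauge_eq_one_iff_mem_frontier hc (mem_interior_iff_mem_nhds.1 h0),
    gauge_smul_of_nonneg (by positivity), smul_eq_mul, inv_mul_cancel₀ hg.ne']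

theorem max_frontier (hK : IsCompact K) (hc : Convex ℝ K) (h0 : (0 : EuclideanSpace ℝ (Fin d)) ∈ interior K)
    {y z : EuclideanSpace ℝ (Fin d)} (hyK : y ∈ K) (hp : 0 < ⟪y, z⟫) (hm : ∀ y' ∈ K, ⟪y', z⟫ ≤ ⟪y, z⟫) :
    y ∈ frontier K := by
  have hy : y ≠ 0 := by rintro rfl; simp at hp
  obtain ⟨l, hl, hlf⟩ := ray hK hc h0 hyK hy
  have := hm _ (hK.isClosed.frontier_subset hlf)
  rw [inner_smul_left] at this
  simp only [conj_trivial] at this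
  have : l = 1 := le_antisymm (by by_contra h; push Not at h; nlinarith) hl
  rwa [this, one_smul] at hlf

theorem cap_dual (hK : IsCompact K) (hc : Convex ℝ K) (h0 : (0 : EuclideanSpace ℝ (Fin d)) ∈ interior K)
    {x p : EuclideanSpace ℝ (Fin d)} (hx : x ∈ K) (hxp : ⟪x, p⟫ = 1) (hp : ∀ y ∈ K, ⟪y, p⟫ ≤ 1)
    {ε : ℝ} (he : 0 < ε) (he2 : ε < 1 / 2) {T : Set (EuclideanSpace ℝ (Fin d))}
    (hT : ∀ z y, y ∈ frontier K → 1 - ε ≤ ⟪y, p⟫ → 0 < ⟪y, z⟫ → (∀ y' ∈ K, ⟪y', z⟫ ≤ ⟪y, z⟫) →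
      (⟪y, z⟫)⁻¹ • z ∈ T)
    {v : EuclideanSpace ℝ (Fin d)} (hv : |⟪x, v⟫| ≤ 2)
    (hv2 : ∀ y ∈ K, ⟪y, p⟫ = 1 - ε → ⟪y - (1 - ε) • x, v⟫ ≤ 1) :
    (3 / 8 : ℝ) • p + ((ε / 8) • v + ((1 / 16 - ε / 8) * ⟪x, v⟫) • p) ∈ coneSet T := by
  set t := ⟪x, v⟫ with ht
  rw [abs_le] at hv
  set r : ℝ := 3 / 8 + t / 16 with hr
  have hr1 : 1 / 4 ≤ r := by rw [hr]; linarith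
  have hr2 : r ≤ 1 / 2 := by rw [hr]; linarith
  have hr0 : 0 < r := by linarith
  set z := p + (ε / (8 * r)) • (v - t • p) with hz
  have hzi : ∀ y, ⟪y, z⟫ = ⟪y, p⟫ + ε / (8 * r) * (⟪y, v⟫ - t * ⟪y, p⟫) := by
    intro y; rw [hz, inner_add_right, inner_smul_right, inner_sub_right, inner_smul_right]
  have hxz : ⟪x, z⟫ = 1 := by rw [hzi, hxp, ← ht]; ring
  have hcoef : ε / (8 * r) ≤ ε / 2 := div_le_div_of_nonneg_left he.le (by norm_num) (by linarith)
  have hcoef0 : 0 < ε / (8 * r) := by positivity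
  have hKe : ∀ y ∈ K, ⟪y, p⟫ = 1 - ε → ⟪y, z⟫ ≤ 1 - ε / 2 := by
    intro y hy hyp
    have h1 := hv2 y hy hyp
    rw [inner_sub_left, inner_smul_left, ← ht] at h1
    simp only [conj_trivial] at h1
    rw [hzi, hyp]
    nlinarith
  obtain ⟨y, hyK, hym⟩ := hK.exists_isMaxOn ⟨x, hx⟩ (f := fun y => ⟪y, z⟫) (by fun_prop)
  have hym' : ∀ y' ∈ K, ⟪y', z⟫ ≤ ⟪y, z⟫ := fun y' hy' => hym hy'
  have hh1 : 1 ≤ ⟪y, z⟫ := by rw [← hxz]; exact hym' x hx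
  have hcap : 1 - ε ≤ ⟪y, p⟫ := by
    by_contra hlt
    push Not at hlt
    have hD : 0 < 1 - ⟪y, p⟫ := by linarith
    set s := ε / (1 - ⟪y, p⟫) with hs
    have hs0 : 0 < s := by positivity
    have hs1 : s ≤ 1 := by rw [hs, div_le_one hD]; linarith
    have hsD : s * (1 - ⟪y, p⟫) = ε := div_mul_cancel₀ _ hD.ne'
    have hm := hc hx hyK (a := 1 - s) (b := s) (by linarith) hs0.le (by ring)
    have h2 := hKe _ hm (by
      rw [inner_add_left, inner_smul_left, inner_smul_left, hxp]
      simp only [conj_trivial]; linarith)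
    rw [inner_add_left, inner_smul_left, inner_smul_left, hxz] at h2
    simp only [conj_trivial] at h2
    nlinarith
  have hh2 : ⟪y, z⟫ ≤ 2 := by
    have hm0 : 0 < ⟪y, p⟫ := by linarith
    have hq0 : 0 ≤ (1 - ε) / ⟪y, p⟫ := div_nonneg (by linarith) hm0.le
    have hq1 : (1 - ε) / ⟪y, p⟫ ≤ 1 := by rw [div_le_one hm0]; exact hcap
    have hm := hc.smul_mem_of_zero_mem (interior_subset h0) hyK ⟨hq0, hq1⟩
    have h2 := hKe _ hm (by
      rw [inner_smul_left]
      simp only [conj_trivial]; exact div_mul_cancel₀ _ hm0.ne')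
    rw [inner_smul_left] at h2
    simp only [conj_trivial] at h2
    rw [div_mul_eq_mul_div, div_le_iff₀ hm0] at h2
    nlinarith [hp y hyK]
  have hpos : 0 < ⟪y, z⟫ := by linarith
  refine ⟨_, hT z y (max_frontier hK hc h0 hyK hpos hym') hcap hpos hym', r * ⟪y, z⟫, by positivity, by nlinarith, ?_⟩
  rw [smul_smul, mul_assoc, mul_inv_cancel₀ hpos.ne', mul_one, hz, smul_add, smul_smul,
    show r * (ε / (8 * r)) = ε / 8 by field_simp, hr]
  module

theorem det_B {d : ℕ} (hd : 1 ≤ d) {x p : EuclideanSpace ℝ (Fin d)} (hxp : ⟪x, p⟫ = 1) {ε : ℝ} (he : 0 < ε)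
    (a : EuclideanSpace ℝ (Fin d)) (V : Set (EuclideanSpace ℝ (Fin d))) :
    volume ((fun v => a + ((ε / 8) • v + ((1 / 16 - ε / 8) * ⟪x, v⟫) • p)) '' V) =
      ENNReal.ofReal (8⁻¹ ^ d * 2⁻¹ * ε ^ (d - 1)) * volume V := by
  let B := (ε / 8) • LinearMap.transvection (innerₛₗ ℝ x) ((1 / (2 * ε) - 1) • p)
  have hB : LinearMap.det B = 8⁻¹ ^ d * 2⁻¹ * ε ^ (d - 1) := by
    simp only [B]
    rw [LinearMap.det_smul, LinearMap.transvection.det, finrank_euclideanSpace_fin]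
    obtain ⟨k, rfl⟩ : ∃ k, d = k + 1 := ⟨d - 1, by omega⟩
    simp only [map_smul, innerₛₗ_apply_apply, hxp, smul_eq_mul, mul_one, Nat.add_sub_cancel]
    rw [div_eq_mul_inv, mul_pow, pow_succ ε]
    field_simp
    ring
  have him : (fun v => a + ((ε / 8) • v + ((1 / 16 - ε / 8) * ⟪x, v⟫) • p)) '' V = (fun w => a + w) '' (B '' V) := by
    rw [Set.image_image]
    refine Set.image_congr fun v _ => ?_
    congr 1
    simp only [B, LinearMap.smul_apply, LinearMap.transvection.apply, innerₛₗ_apply_apply, smul_add, smul_smul]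
    congr 2
    field_simp
    ring
  rw [him, Set.image_add_left, measure_preimage_add, Measure.addHaar_image_linearMap, hB, abs_of_pos (by positivity)]

theorem cap_vol (hd : 1 ≤ d) (hK : IsCompact K) (hc : Convex ℝ K) (h0 : (0 : EuclideanSpace ℝ (Fin d)) ∈ interior K)
    {x p : EuclideanSpace ℝ (Fin d)} (hx : x ∈ K) (hxp : ⟪x, p⟫ = 1) (hp : ∀ y ∈ K, ⟪y, p⟫ ≤ 1)
    {ε : ℝ} (he : 0 < ε) (he2 : ε < 1 / 2) {S T : Set (EuclideanSpace ℝ (Fin d))}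
    (hS : ∀ y ∈ frontier K, 1 - ε ≤ ⟪y, p⟫ → y ∈ S)
    (hT : ∀ z y, y ∈ frontier K → 1 - ε ≤ ⟪y, p⟫ → 0 < ⟪y, z⟫ → (∀ y' ∈ K, ⟪y', z⟫ ≤ ⟪y, z⟫) →
      (⟪y, z⟫)⁻¹ • z ∈ T) :
    ENNReal.ofReal (512⁻¹ ^ d * ε ^ (d - 1)) ≤
      ENNReal.ofReal ((d : ℝ) ^ d) * (volume (coneSet S) * volume (coneSet T)) := by
  have he1 : 0 < 1 - ε := by linarith
  set Ke : Set (EuclideanSpace ℝ (Fin d)) := K ∩ {y | ⟪y, p⟫ = 1 - ε} with hKe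
  have hKec : IsCompact Ke := hK.inter_right (isClosed_eq (by fun_prop) continuous_const)
  have hKecv : Convex ℝ Ke := by
    refine hc.inter ?_
    intro y hy z hz a b ha hb hab
    have hy' : ⟪y, p⟫ = 1 - ε := hy
    have hz' : ⟪z, p⟫ = 1 - ε := hz
    change ⟪a • y + b • z, p⟫ = 1 - ε
    rw [inner_add_left, inner_smul_left, inner_smul_left, hy', hz']
    simp only [conj_trivial]
    rw [← add_mul, hab, one_mul]
  set P := coneSet Ke with hP
  have hPc : IsCompact P := by
    have : P = (fun q : ℝ × EuclideanSpace ℝ (Fin d) => q.1 • q.2) '' (Set.Icc 0 1 ×ˢ Ke) := by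
      ext w; constructor
      · rintro ⟨y, hy, r, hr0, hr1, rfl⟩; exact ⟨(r, y), ⟨⟨hr0, hr1⟩, hy⟩, rfl⟩
      · rintro ⟨⟨r, y⟩, ⟨⟨hr0, hr1⟩, hy⟩, rfl⟩; exact ⟨y, hy, r, hr0, hr1, rfl⟩
    rw [this]
    exact (isCompact_Icc.prod hKec).image (by fun_prop)
  have hPcv : Convex ℝ P := by
    have : P = convexJoin ℝ {0} Ke := by
      ext w
      rw [mem_convexJoin]
      constructor
      · rintro ⟨y, hy, r, hr0, hr1, rfl⟩
        exact ⟨0, rfl, y, hy, 1 - r, r, by linarith, hr0, by ring, by simp⟩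
      · rintro ⟨_, rfl, y, hy, a, b, ha, hb, hab, rfl⟩
        exact ⟨y, hy, b, hb, by linarith, by simp⟩
    rw [this]
    exact (convex_singleton 0).convexJoin hKecv
  have hxi : (1 - ε) • x ∈ interior K := by
    have := hc.combo_interior_self_mem_interior h0 hx he he1.le (by ring)
    simpa using this
  have hxe : (1 - ε) • x ∈ Ke := ⟨interior_subset hxi, by
    change ⟪(1 - ε) • x, p⟫ = 1 - ε
    rw [inner_smul_left, hxp]; simp⟩
  have hPn : P ∈ nhds (((1 - ε) / 2) • x) := by
    have hin : ⟪((1 - ε) / 2) • x, p⟫ = (1 - ε) / 2 := by rw [inner_smul_left, hxp]; simp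
    have c2 : ContinuousAt (fun w : EuclideanSpace ℝ (Fin d) => ⟪w, p⟫) (((1 - ε) / 2) • x) := by fun_prop
    have c1 : ContinuousAt (fun w : EuclideanSpace ℝ (Fin d) => ((1 - ε) / ⟪w, p⟫) • w) (((1 - ε) / 2) • x) := by
      refine ContinuousAt.smul (ContinuousAt.div continuousAt_const c2 ?_) continuousAt_id
      rw [hin]; positivity
    have h1 := c1.preimage_mem_nhds (t := K) (by
      rw [hin, smul_smul, show (1 - ε) / ((1 - ε) / 2) * ((1 - ε) / 2) = 1 - ε by field_simp]
      exact mem_interior_iff_mem_nhds.1 hxi)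
    have h2 := c2.preimage_mem_nhds (t := Set.Ioo 0 (1 - ε)) (Ioo_mem_nhds (by rw [hin]; positivity) (by rw [hin]; linarith))
    filter_upwards [h1, h2] with w hw1 hw2
    have hw0 : 0 < ⟪w, p⟫ := hw2.1
    have hw3 : ⟪w, p⟫ < 1 - ε := hw2.2
    refine ⟨((1 - ε) / ⟪w, p⟫) • w, ⟨hw1, ?_⟩, ⟪w, p⟫ / (1 - ε), by positivity, by rw [div_le_one he1]; exact hw3.le, ?_⟩
    · change ⟪((1 - ε) / ⟪w, p⟫) • w, p⟫ = 1 - ε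
      rw [inner_smul_left]; simp only [conj_trivial]; exact div_mul_cancel₀ _ hw0.ne'
    · rw [smul_smul, show ⟪w, p⟫ / (1 - ε) * ((1 - ε) / ⟪w, p⟫) = 1 by field_simp, one_smul]
  have hPv : volume P ≠ 0 := (Measure.measure_pos_of_mem_nhds _ hPn).ne'
  have hPS : P ⊆ coneSet S := by
    rintro _ ⟨y, hy, r, hr0, hr1, rfl⟩
    have hyp : ⟪y, p⟫ = 1 - ε := hy.2
    have hy0 : y ≠ 0 := by rintro rfl; simp at hyp; linarith
    obtain ⟨l, hl, hlf⟩ := ray hK hc h0 hy.1 hy0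
    have hl0 : 0 < l := by linarith
    refine ⟨l • y, hS _ hlf ?_, r / l, by positivity, by rw [div_le_one hl0]; linarith, ?_⟩
    · rw [inner_smul_left, hyp]; simp only [conj_trivial]; nlinarith
    · rw [smul_smul, div_mul_cancel₀ _ hl0.ne']
  have h0P : (0 : EuclideanSpace ℝ (Fin d)) ∈ P := ⟨_, hxe, 0, le_rfl, zero_le_one, by simp⟩
  have hKeP : ∀ y ∈ Ke, y ∈ P := fun y hy => ⟨y, hy, 1, zero_le_one, le_rfl, by simp⟩
  have hLc : IsCompact (P - P) := by rw [sub_eq_add_neg]; exact hPc.add hPc.neg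
  have hLs : ∀ w ∈ P - P, -w ∈ P - P := by
    rintro _ ⟨a, ha, b, hb, rfl⟩; exact ⟨b, hb, a, ha, by simp⟩
  have hL0 : (0 : EuclideanSpace ℝ (Fin d)) ∈ interior (P - P) := by
    rw [mem_interior_iff_mem_nhds]
    have c : ContinuousAt (fun w : EuclideanSpace ℝ (Fin d) => w + ((1 - ε) / 2) • x) 0 := by fun_prop
    have := c.preimage_mem_nhds (t := P) (by simpa using hPn)
    filter_upwards [this] with w hw
    exact ⟨_, hw, _, mem_of_mem_nhds hPn, by simp⟩
  have bm := bm_sym hLc (hPcv.sub hPcv) hLs hL0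
  have rs := rs_weak hPc hPcv hPv
  have hdual : (fun v => (3 / 8 : ℝ) • p + ((ε / 8) • v + ((1 / 16 - ε / 8) * ⟪x, v⟫) • p)) '' polarBody (P - P) ⊆ coneSet T := by
    rintro _ ⟨v, hv, rfl⟩
    refine cap_dual hK hc h0 hx hxp hp he he2 hT ?_ ?_
    · have a1 := hv _ ⟨_, hKeP _ hxe, _, h0P, rfl⟩
      have a2 := hv _ ⟨_, h0P, _, hKeP _ hxe, rfl⟩
      simp only [sub_zero, zero_sub, inner_neg_left, inner_smul_left, conj_trivial] at a1 a2
      rw [abs_le]; constructor <;> nlinarith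
    · intro y hy hyp
      exact hv _ ⟨_, hKeP y ⟨hy, hyp⟩, _, hKeP _ hxe, rfl⟩
  have hT2 := measure_mono (μ := volume) hdual
  rw [det_B hd hxp he] at hT2
  have hv1 : volume (P - P) ≤ ENNReal.ofReal (4 ^ d) * volume (coneSet S) := rs.trans (mul_le_mul' le_rfl (measure_mono hPS))
  set c1 : ℝ := 8⁻¹ ^ d * 2⁻¹ * ε ^ (d - 1) with hc1
  have hc10 : 0 < c1 := by positivity
  have step : ENNReal.ofReal c1 * ENNReal.ofReal (8⁻¹ ^ d) ≤
      ENNReal.ofReal (4 ^ d) * (ENNReal.ofReal ((d : ℝ) ^ d) * (volume (coneSet S) * volume (coneSet T))) := by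
    calc ENNReal.ofReal c1 * ENNReal.ofReal (8⁻¹ ^ d)
        ≤ ENNReal.ofReal c1 * (ENNReal.ofReal ((d : ℝ) ^ d) * (volume (P - P) * volume (polarBody (P - P)))) := mul_le_mul' le_rfl bm
      _ = ENNReal.ofReal ((d : ℝ) ^ d) * (volume (P - P) * (ENNReal.ofReal c1 * volume (polarBody (P - P)))) := by ring
      _ ≤ ENNReal.ofReal ((d : ℝ) ^ d) * ((ENNReal.ofReal (4 ^ d) * volume (coneSet S)) * volume (coneSet T)) :=
          mul_le_mul' le_rfl (mul_le_mul' hv1 hT2)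
      _ = _ := by ring
  have step2 := mul_le_mul' (le_refl (ENNReal.ofReal (4⁻¹ ^ d))) step
  rw [← mul_assoc (ENNReal.ofReal (4⁻¹ ^ d)) (ENNReal.ofReal (4 ^ d)), ← ENNReal.ofReal_mul (by positivity : (0 : ℝ) ≤ 4⁻¹ ^ d), ← mul_pow,
    inv_mul_cancel₀ (by norm_num), one_pow, ENNReal.ofReal_one, one_mul, ← ENNReal.ofReal_mul hc10.le,
    ← ENNReal.ofReal_mul (by positivity)] at step2
  refine le_trans (ENNReal.ofReal_le_ofReal ?_) step2
  have e1 : (512⁻¹ : ℝ) ^ d = 4⁻¹ ^ d * 8⁻¹ ^ d * 8⁻¹ ^ d * 2⁻¹ ^ d := by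
    rw [← mul_pow, ← mul_pow, ← mul_pow]; norm_num
  have e2 : (2⁻¹ : ℝ) ^ d ≤ 2⁻¹ := pow_le_of_le_one (by norm_num) (by norm_num) (by omega)
  rw [e1, hc1]
  have : (0 : ℝ) ≤ 4⁻¹ ^ d * 8⁻¹ ^ d * 8⁻¹ ^ d * ε ^ (d - 1) := by positivity
  nlinarith [mul_le_mul_of_nonneg_left e2 this]
end Cap
end BM

namespace BM
open scoped Pointwise

theorem amgm {a b : ℝ≥0∞} {k : ℝ} (hk : 0 ≤ k) (hm : ENNReal.ofReal (k ^ 2) ≤ a * b) :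
    ENNReal.ofReal k ≤ (1 / 2 : ℝ≥0∞) * (a + b) := by
  rcases eq_or_ne a ⊤ with rfl | ha
  · simp
  rcases eq_or_ne b ⊤ with rfl | hb
  · simp
  lift a to NNReal using ha
  lift b to NNReal using hb
  have h2 : (1 / 2 : ℝ≥0∞) = ENNReal.ofReal (1 / 2) := by
    rw [ENNReal.ofReal_div_of_pos two_pos]; simp
  rw [← ENNReal.ofReal_coe_nnreal (p := a), ← ENNReal.ofReal_coe_nnreal (p := b)] at *
  rw [← ENNReal.ofReal_mul a.coe_nonneg] at hm
  rw [← ENNReal.ofReal_add a.coe_nonneg b.coe_nonneg, h2, ← ENNReal.ofReal_mul (by norm_num)]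
  have h3 := (ENNReal.ofReal_le_ofReal_iff (mul_nonneg a.coe_nonneg b.coe_nonneg)).1 hm
  apply ENNReal.ofReal_le_ofReal
  have ha := a.coe_nonneg
  have hb := b.coe_nonneg
  refine (pow_le_pow_iff_left₀ hk (by positivity) two_ne_zero).1 ?_
  nlinarith [sq_nonneg ((a : ℝ) - b)]
end BM

/-- There is an absolute constant `c > 0` such that: for `d ≥ 2` and a convex body
`K ⊆ ℝ^d` with `0` in its interior, smooth strictly convex boundary (unique outer unit
normal `ν x` at each boundary point, no segments on `∂K`), and
`vol(K)·vol(K°) ≤ A·d^{-d}` with `A ≥ 1`, the measure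
`μ(S) = (1/2)(vol(C(S))/vol(K) + vol(C(S*))/vol(K°))`, where `x* = ν_x/⟨x, ν_x⟩`,
satisfies `μ(∂K) = 1` and `μ(S(x,ε)) ≥ c^d A^{-1/2} ε^{(d-1)/2}` for every `x ∈ ∂K`
and `ε ∈ (0,1/2)`, where `S(x,ε) = {y ∈ ∂K : ⟨y, ν_x⟩ ≥ (1−ε)⟨x, ν_x⟩}`. -/
theorem stmt18 :
    ∃ c : ℝ, 0 < c ∧ ∀ d : ℕ, 2 ≤ d →
      ∀ K : Set (EuclideanSpace ℝ (Fin d)),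
        IsCompact K → Convex ℝ K →
        (0 : EuclideanSpace ℝ (Fin d)) ∈ interior K →
        ∀ ν : EuclideanSpace ℝ (Fin d) → EuclideanSpace ℝ (Fin d),
        (∀ x ∈ frontier K, ‖ν x‖ = 1 ∧ ∀ y ∈ K, ⟪y, ν x⟫ ≤ ⟪x, ν x⟫) →
        (∀ x ∈ frontier K, ∀ u : EuclideanSpace ℝ (Fin d),
          ‖u‖ = 1 → (∀ y ∈ K, ⟪y, u⟫ ≤ ⟪x, u⟫) → u = ν x) →
        (∀ x ∈ frontier K, ∀ y ∈ frontier K, segment ℝ x y ⊆ frontier K → x = y) →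
        ∀ A : ℝ, 1 ≤ A →
        volume K * volume (polarBody K) ≤ ENNReal.ofReal (A / (d : ℝ) ^ d) →
        (1 / 2 : ℝ≥0∞) *
            (volume (coneSet (frontier K)) / volume K +
              volume (coneSet ((fun z => (⟪z, ν z⟫)⁻¹ • ν z) '' frontier K)) /
                volume (polarBody K)) = 1 ∧
        ∀ x ∈ frontier K, ∀ ε : ℝ, 0 < ε → ε < 1 / 2 →
          ENNReal.ofReal (c ^ d * (Real.sqrt A)⁻¹ * ε ^ (((d : ℝ) - 1) / 2)) ≤
            (1 / 2 : ℝ≥0∞) *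
              (volume (coneSet
                  {y ∈ frontier K | (1 - ε) * ⟪x, ν x⟫ ≤ ⟪y, ν x⟫}) / volume K +
                volume (coneSet ((fun z => (⟪z, ν z⟫)⁻¹ • ν z) ''
                  {y ∈ frontier K | (1 - ε) * ⟪x, ν x⟫ ≤ ⟪y, ν x⟫})) /
                  volume (polarBody K)) := by
  refine ⟨Real.sqrt 512⁻¹, by positivity, ?_⟩
  intro d hd K hK hc h0 ν hν huniq _ A hA hvol
  have hn : K ∈ nhds (0 : EuclideanSpace ℝ (Fin d)) := mem_interior_iff_mem_nhds.1 h0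
  obtain ⟨ρ, hρ, hball⟩ := Metric.mem_nhds_iff.1 hn
  have hpos : ∀ x ∈ frontier K, 0 < ⟪x, ν x⟫ := by
    intro x hx
    obtain ⟨h1, h2⟩ := hν x hx
    have := h2 ((ρ / 2) • ν x) (hball (by
      rw [mem_ball_zero_iff, norm_smul, h1, Real.norm_of_nonneg (by positivity)]; linarith))
    rw [inner_smul_left, real_inner_self_eq_norm_sq, h1] at this
    simp only [conj_trivial] at this
    linarith
  have hstar : ∀ z y, y ∈ frontier K → 0 < ⟪y, z⟫ → (∀ y' ∈ K, ⟪y', z⟫ ≤ ⟪y, z⟫) →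
      (⟪y, ν y⟫)⁻¹ • ν y = (⟪y, z⟫)⁻¹ • z := by
    intro z y hy hp hm
    have hz : z ≠ 0 := by rintro rfl; simp at hp
    have hzp : 0 < ‖z‖ := norm_pos_iff.2 hz
    have hu := huniq y hy (‖z‖⁻¹ • z) (by rw [norm_smul, norm_inv, norm_norm, inv_mul_cancel₀ hzp.ne'])
      (fun y' hy' => by
        rw [inner_smul_right, inner_smul_right]
        exact mul_le_mul_of_nonneg_left (hm y' hy') (by positivity))
    rw [← hu, inner_smul_right, smul_smul]
    congr 1
    field_simp
  have hKv : volume K ≠ 0 := (Measure.measure_pos_of_mem_nhds _ hn).ne'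
  have hKt : volume K ≠ ⊤ := hK.measure_lt_top.ne
  have hne : (frontier K).Nonempty := by
    have : ∃ y ∈ K, y ≠ 0 := by
      obtain ⟨v, hv⟩ : ∃ v : EuclideanSpace ℝ (Fin d), v ≠ 0 := by
        have : Nontrivial (EuclideanSpace ℝ (Fin d)) := by
          have : Nonempty (Fin d) := ⟨⟨0, by omega⟩⟩
          infer_instance
        exact exists_ne 0
      have hvp : 0 < ‖v‖ := norm_pos_iff.2 hv
      refine ⟨(ρ / 2 / ‖v‖) • v, hball ?_, smul_ne_zero (by positivity) hv⟩
      rw [mem_ball_zero_iff, norm_smul, Real.norm_of_nonneg (by positivity), div_mul_cancel₀ _ hvp.ne']; linarith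
    obtain ⟨y, hy, hy0⟩ := this
    obtain ⟨l, _, hl⟩ := BM.ray hK hc h0 hy hy0
    exact ⟨_, hl⟩
  obtain ⟨f0, hf0⟩ := hne
  have hfK : frontier K ⊆ K := hK.isClosed.frontier_subset
  have cone1 : coneSet (frontier K) = K := by
    apply Set.Subset.antisymm
    · rintro _ ⟨y, hy, r, hr0, hr1, rfl⟩
      exact hc.smul_mem_of_zero_mem (interior_subset h0) (hfK hy) ⟨hr0, hr1⟩
    · intro y hy
      by_cases hy0 : y = 0
      · exact ⟨f0, hf0, 0, le_rfl, zero_le_one, by simp [hy0]⟩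
      · obtain ⟨l, hl, hlf⟩ := BM.ray hK hc h0 hy hy0
        have hl0 : 0 < l := by linarith
        refine ⟨_, hlf, l⁻¹, by positivity, inv_le_one_of_one_le₀ hl, ?_⟩
        rw [smul_smul, inv_mul_cancel₀ hl0.ne', one_smul]
  have cone2 : coneSet ((fun z => (⟪z, ν z⟫)⁻¹ • ν z) '' frontier K) = polarBody K := by
    apply Set.Subset.antisymm
    · rintro _ ⟨_, ⟨y, hy, rfl⟩, r, hr0, hr1, rfl⟩
      intro w hw
      have h1 := (hν y hy).2 w hw
      have h2 := hpos y hy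
      rw [inner_smul_right, inner_smul_right]
      have : (⟪y, ν y⟫)⁻¹ * ⟪w, ν y⟫ ≤ 1 := by rw [inv_mul_le_iff₀ h2]; linarith
      nlinarith
    · intro z hz
      by_cases hz0 : z = 0
      · exact ⟨_, ⟨f0, hf0, rfl⟩, 0, le_rfl, zero_le_one, by simp [hz0]⟩
      · have hzp : 0 < ‖z‖ := norm_pos_iff.2 hz0
        obtain ⟨y, hyK, hym⟩ := hK.exists_isMaxOn ⟨0, interior_subset h0⟩ (f := fun y => ⟪y, z⟫) (by fun_prop)
        have hym' : ∀ y' ∈ K, ⟪y', z⟫ ≤ ⟪y, z⟫ := fun y' hy' => hym hy'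
        have hp : 0 < ⟪y, z⟫ := by
          have := hym' ((ρ / 2 / ‖z‖) • z) (hball (by
            rw [mem_ball_zero_iff, norm_smul, Real.norm_of_nonneg (by positivity), div_mul_cancel₀ _ hzp.ne']; linarith))
          refine lt_of_lt_of_le ?_ this
          rw [inner_smul_left, real_inner_self_eq_norm_sq]
          simp only [conj_trivial]; positivity
        have hyf := BM.max_frontier hK hc h0 hyK hp hym'
        refine ⟨_, ⟨y, hyf, rfl⟩, ⟪y, z⟫, hp.le, hz y hyK, ?_⟩
        beta_reduce
        rw [hstar z y hyf hp hym', smul_smul, mul_inv_cancel₀ hp.ne', one_smul]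
  have hPv : volume (polarBody K) ≠ 0 := by
    obtain ⟨M, hM⟩ := hK.isBounded.exists_norm_le
    have hMp : 0 < max M 1 := lt_of_lt_of_le one_pos (le_max_right _ _)
    refine (Measure.measure_pos_of_mem_nhds _ (x := 0) (Filter.mem_of_superset (Metric.ball_mem_nhds _ (inv_pos.2 hMp)) ?_)).ne'
    intro y hy z hz
    have hy' : ‖y‖ < (max M 1)⁻¹ := by simpa using hy
    refine (real_inner_le_norm _ _).trans ?_
    calc ‖z‖ * ‖y‖ ≤ max M 1 * (max M 1)⁻¹ := mul_le_mul ((hM z hz).trans (le_max_left _ _)) hy'.le (norm_nonneg _) hMp.le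
      _ = 1 := mul_inv_cancel₀ hMp.ne'
  have hPt : volume (polarBody K) ≠ ⊤ := by
    intro h
    rw [h, ENNReal.mul_top hKv] at hvol
    exact absurd (top_le_iff.1 hvol) ENNReal.ofReal_ne_top
  have hdp : (0 : ℝ) < (d : ℝ) ^ d := by positivity
  have hA0 : 0 < A := by linarith
  refine ⟨?_, ?_⟩
  · rw [cone1, cone2, ENNReal.div_self hKv hKt, ENNReal.div_self hPv hPt, one_add_one_eq_two]
    exact ENNReal.div_mul_cancel two_ne_zero ENNReal.ofNat_ne_top
  intro x hx ε he he2
  set S := {y ∈ frontier K | (1 - ε) * ⟪x, ν x⟫ ≤ ⟪y, ν x⟫} with hS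
  have hxp := hpos x hx
  have hmem : ∀ y ∈ frontier K, 1 - ε ≤ ⟪y, (⟪x, ν x⟫)⁻¹ • ν x⟫ → y ∈ S := by
    intro y hy h
    refine ⟨hy, ?_⟩
    rw [inner_smul_right, inv_mul_eq_div, le_div_iff₀ hxp] at h
    exact h
  have main := BM.cap_vol (by omega) hK hc h0 (hfK hx) (p := (⟪x, ν x⟫)⁻¹ • ν x)
    (by rw [inner_smul_right, inv_mul_cancel₀ hxp.ne'])
    (by
      intro y hy
      rw [inner_smul_right, inv_mul_le_iff₀ hxp]; linarith [(hν x hx).2 y hy]) he he2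
    (S := S) (T := (fun z => (⟪z, ν z⟫)⁻¹ • ν z) '' S) hmem
    (by
      intro z y hy hcap hp hm
      exact ⟨y, hmem y hy hcap, hstar z y hy hp hm⟩)
  apply BM.amgm (by positivity)
  set V1 := volume (coneSet S)
  set V2 := volume (coneSet ((fun z => (⟪z, ν z⟫)⁻¹ • ν z) '' S))
  have hk : (Real.sqrt 512⁻¹ ^ d * (Real.sqrt A)⁻¹ * ε ^ (((d : ℝ) - 1) / 2)) ^ 2 = 512⁻¹ ^ d * ε ^ (d - 1) * A⁻¹ := by
    have e1 : (ε ^ (((d : ℝ) - 1) / 2)) ^ 2 = ε ^ (d - 1) := by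
      rw [← Real.rpow_natCast, ← Real.rpow_mul he.le, ← Real.rpow_natCast ε (d - 1)]
      congr 1
      rw [Nat.cast_sub (by omega)]; push_cast; ring
    rw [mul_pow, mul_pow, e1, ← pow_mul, mul_comm d 2, pow_mul, Real.sq_sqrt (by norm_num), inv_pow (Real.sqrt A), Real.sq_sqrt hA0.le]
    ring
  rw [hk]
  have e : V1 / volume K * (V2 / volume (polarBody K)) = V1 * V2 / (volume K * volume (polarBody K)) := by
    rw [ENNReal.div_eq_inv_mul, ENNReal.div_eq_inv_mul, ENNReal.div_eq_inv_mul,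
      ENNReal.mul_inv (Or.inl hKv) (Or.inl hKt)]
    ring
  rw [e, ENNReal.le_div_iff_mul_le (Or.inl (mul_ne_zero hKv hPv)) (Or.inl (ENNReal.mul_ne_top hKt hPt))]
  refine (mul_le_mul' le_rfl hvol).trans ?_
  rw [← ENNReal.ofReal_mul (by positivity)]
  have m2 := mul_le_mul' (le_refl (ENNReal.ofReal (((d : ℝ) ^ d)⁻¹))) main
  rw [← mul_assoc, ← ENNReal.ofReal_mul (by positivity), ← ENNReal.ofReal_mul (by positivity),
    inv_mul_cancel₀ hdp.ne', ENNReal.ofReal_one, one_mul] at m2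
  refine le_trans (le_of_eq ?_) m2
  congr 1
  field_simp
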